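/- There exists a ∅''-computable function f : ℕ × ℕ → ℕ such that for every e, i ∈ ℕ: if Φ_e^{∅'} is total and is a martingale, and i is a lowness index for some set L (i.e., Φ_i^{∅'} is the characteristic function of L', with L low), then there exists a set B on which the martingale Φ_e^{∅'} does not succeed such that f(e,i) is a lowness index for L ⊕ B (i.e., Φ_{f(e,i)}^{∅'} is the characteristic function of (L ⊕ B)'). -/

import Mathlib

/-!
Preamble: oracle computability, Turing reducibility, the jump, martingales,
and Martin-Löf randomness, developed from scratch.
-/

open scoped Classical

/-- The characteristic function of a set of naturals. -/
noncomputable def chi (A : Set ℕ) : ℕ → ℕ :=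
  fun n => if n ∈ A then 1 else 0

/-- Partial functions recursive in a (total) oracle `O : ℕ → ℕ`.
This mirrors `Nat.Partrec`, with an additional constructor for the oracle. -/
inductive RecIn (O : ℕ → ℕ) : (ℕ →. ℕ) → Prop
  | oracle : RecIn O (fun n => Part.some (O n))
  | zero : RecIn O (fun _ => Part.some 0)
  | succ : RecIn O (fun n => Part.some (n + 1))
  | left : RecIn O (fun n => Part.some (Nat.unpair n).1)
  | right : RecIn O (fun n => Part.some (Nat.unpair n).2)
  | pair {f g} : RecIn O f → RecIn O g → RecIn O (fun n => Nat.pair <$> f n <*> g n)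
  | comp {f g} : RecIn O f → RecIn O g → RecIn O (fun n => g n >>= f)
  | prec {f g} :
      RecIn O f → RecIn O g →
      RecIn O
        (Nat.unpaired fun a n =>
          n.rec (f a) fun y IH => do
            let i ← IH
            g (Nat.pair a (Nat.pair y i)))
  | rfind {f} :
      RecIn O f →
      RecIn O (fun a => Nat.rfind fun n => (fun m => m = 0) <$> f (Nat.pair a n))

/-- Codes for oracle machines. -/
inductive OCode : Type
  | zero : OCode
  | succ : OCode
  | left : OCode
  | right : OCode
  | oracle : OCode
  | pair : OCode → OCode → OCode
  | comp : OCode → OCode → OCode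
  | prec : OCode → OCode → OCode
  | rfind' : OCode → OCode

/-- Evaluation of oracle codes relative to a total oracle. -/
def evalo (O : ℕ → ℕ) : OCode → ℕ →. ℕ
  | .zero => fun _ => Part.some 0
  | .succ => fun n => Part.some (n + 1)
  | .left => fun n => Part.some (Nat.unpair n).1
  | .right => fun n => Part.some (Nat.unpair n).2
  | .oracle => fun n => Part.some (O n)
  | .pair cf cg => fun n => Nat.pair <$> evalo O cf n <*> evalo O cg n
  | .comp cf cg => fun n => evalo O cg n >>= evalo O cf
  | .prec cf cg =>
      Nat.unpaired fun a n =>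
        n.rec (evalo O cf a) fun y IH => do
          let i ← IH
          evalo O cg (Nat.pair a (Nat.pair y i))
  | .rfind' cf =>
      Nat.unpaired fun a m =>
        (Nat.rfind fun n => (fun x => x = 0) <$> evalo O cf (Nat.pair a (n + m))).map (· + m)

/-- A surjective listing of oracle codes. -/
def ofNatOCode : ℕ → OCode
  | 0 => .zero
  | 1 => .succ
  | 2 => .left
  | 3 => .right
  | 4 => .oracle
  | n + 5 =>
    have hm : n.div2.div2 < n + 5 := by
      rw [Nat.div2_val, Nat.div2_val]
      exact lt_of_le_of_lt (le_trans (Nat.div_le_self _ _) (Nat.div_le_self _ _))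
        (Nat.lt_succ_of_le (Nat.le_add_right _ 4))
    have _m1 : n.div2.div2.unpair.1 < n + 5 :=
      lt_of_le_of_lt (Nat.unpair_left_le _) hm
    have _m2 : n.div2.div2.unpair.2 < n + 5 :=
      lt_of_le_of_lt (Nat.unpair_right_le _) hm
    match n.bodd, n.div2.bodd with
    | false, false => .pair (ofNatOCode n.div2.div2.unpair.1) (ofNatOCode n.div2.div2.unpair.2)
    | false, true  => .comp (ofNatOCode n.div2.div2.unpair.1) (ofNatOCode n.div2.div2.unpair.2)
    | true , false => .prec (ofNatOCode n.div2.div2.unpair.1) (ofNatOCode n.div2.div2.unpair.2)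
    | true , true  => .rfind' (ofNatOCode n.div2.div2)

/-- `Phi O e` is the `e`-th partial `O`-computable function `Φ_e^O`. -/
def Phi (O : ℕ → ℕ) (e : ℕ) : ℕ →. ℕ := evalo O (ofNatOCode e)

/-- The Turing jump `A'` of a set `A`. -/
noncomputable def jump (A : Set ℕ) : Set ℕ := {e | (Phi (chi A) e e).Dom}

/-- The halting set `∅'`. -/
noncomputable def K : Set ℕ := jump ∅

/-- Turing reducibility between sets: `TRed B A` means `B ≤_T A`. -/
noncomputable def TRed (B A : Set ℕ) : Prop :=
  RecIn (chi A) (fun n => Part.some (chi B n))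

/-- The effective join of two sets. -/
def join (A B : Set ℕ) : Set ℕ :=
  {n | (∃ a ∈ A, n = 2 * a) ∨ (∃ b ∈ B, n = 2 * b + 1)}

/-- A set is low if its jump is Turing reducible to `∅'`. -/
noncomputable def Low (L : Set ℕ) : Prop := TRed (jump L) K

/-- The function `f : α → β` presented as an oracle on `ℕ`, via the encodings. -/
def fnOracle {α β : Type} [Encodable α] [Encodable β] (f : α → β) : ℕ → ℕ :=
  fun n => Encodable.encode ((Encodable.decode (α := α) n).map f)

/-- `FRed f A` means the function `f` is Turing reducible to the set `A`. -/
noncomputable def FRed {α β : Type} [Encodable α] [Encodable β] (f : α → β) (A : Set ℕ) : Prop :=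
  RecIn (chi A) (fun n => Part.some (fnOracle f n))

/-- `FFRed g f` means the function `g` is Turing reducible to the function `f`. -/
def FFRed {α β γ δ : Type} [Encodable α] [Encodable β] [Encodable γ] [Encodable δ]
    (g : γ → δ) (f : α → β) : Prop :=
  RecIn (fnOracle f) (fun n => Part.some (fnOracle g n))

/-- A martingale: a nonnegative rational-valued function on finite binary strings
satisfying the averaging condition `2 M(σ) = M(σ0) + M(σ1)`. -/
def IsMartingale (M : List Bool → ℚ) : Prop :=
  (∀ σ, 0 ≤ M σ) ∧ ∀ σ, 2 * M σ = M (σ ++ [false]) + M (σ ++ [true])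

/-- The length-`n` initial segment of the characteristic sequence of `A`. -/
noncomputable def seg (A : Set ℕ) (n : ℕ) : List Bool :=
  (List.range n).map fun i => if i ∈ A then true else false

/-- A martingale succeeds on a set `A` if `limsup_n M(A↾n) = ∞`. -/
noncomputable def Succeeds (M : List Bool → ℚ) (A : Set ℕ) : Prop :=
  ∀ q : ℚ, ∃ n, q < M (seg A n)

/-- `H(A)`: the mass problem of infinite subsets or cosubsets of `A`. -/
def Hset (A : Set ℕ) : Set (Set ℕ) :=
  {S | S.Infinite ∧ (S ⊆ A ∨ S ⊆ Aᶜ)}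

/-- Muchnik reducibility: `MuchnikLe P Q` iff every member of `Q` computes a member of `P`. -/
noncomputable def MuchnikLe (P Q : Set (Set ℕ)) : Prop :=
  ∀ B ∈ Q, ∃ A ∈ P, TRed A B

/-- A set of naturals is computably enumerable. -/
def CE (W : Set ℕ) : Prop :=
  ∃ g : ℕ →. ℕ, RecIn (fun _ => 0) g ∧ ∀ n, n ∈ W ↔ (g n).Dom

/-- A Martin-Löf test: a uniformly c.e. sequence of sets of strings `U n`,
with the open set generated by `U n` having measure at most `2^{-n}`. -/
def MLTest (U : ℕ → Set (List Bool)) : Prop :=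
  CE {p : ℕ | ∃ σ ∈ U (Nat.unpair p).1, (Nat.unpair p).2 = Encodable.encode σ} ∧
  ∀ n, (∑' σ : (U n), ((1 : ENNReal) / 2) ^ (σ : List Bool).length) ≤ (1 / 2) ^ n

/-- A set is 1-random (Martin-Löf random) if for every Martin-Löf test there is
an `n` such that no initial segment of the set lies in `U n`. -/
noncomputable def MLRandom (A : Set ℕ) : Prop :=
  ∀ U : ℕ → Set (List Bool), MLTest U → ∃ n, ∀ m, seg A m ∉ U n


open scoped Classical
open Encodable

/-! Part 1: uniform computability, translation to ordinary codes -/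

def UC (F : (ℕ → ℕ) → ℕ →. ℕ) : Prop := ∃ c, ∀ O n, evalo O c n = F O n

theorem evalo_pair (O a b n) : evalo O (.pair a b) n =
    (evalo O a n).bind (fun x => (evalo O b n).bind fun y => Part.some (Nat.pair x y)) := by
  simp only [evalo, Seq.seq, Part.map_eq_map, Part.bind_map, Part.bind_some_eq_map]
theorem evalo_comp (O a b n) : evalo O (.comp a b) n =
    (evalo O b n).bind (fun x => evalo O a x) := rfl
theorem evalo_prec (O a b n) : evalo O (.prec a b) n =
    Nat.rec (motive := fun _ => Part ℕ) (evalo O a n.unpair.1) (fun y IH => IH.bind fun i =>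
      evalo O b (Nat.pair n.unpair.1 (Nat.pair y i))) n.unpair.2 := rfl
theorem evalo_rfind (O a n) : evalo O (.rfind' a) n =
    (Nat.rfind fun k => (evalo O a (Nat.pair n.unpair.1 (k + n.unpair.2))).map
      (fun x => decide (x = 0))).map (· + n.unpair.2) := rfl

theorem UC.of_primrec {f : ℕ → ℕ} (h : Nat.Primrec f) : UC (fun _ n => Part.some (f n)) := by
  induction h with
  | zero => exact ⟨.zero, fun _ _ => rfl⟩
  | succ => exact ⟨.succ, fun _ _ => rfl⟩
  | left => exact ⟨.left, fun _ _ => rfl⟩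
  | right => exact ⟨.right, fun _ _ => rfl⟩
  | pair _ _ ha hb =>
    obtain ⟨a, ha⟩ := ha; obtain ⟨b, hb⟩ := hb
    exact ⟨.pair a b, fun O n => by simp [evalo_pair, ha, hb]⟩
  | comp _ _ ha hb =>
    obtain ⟨a, ha⟩ := ha; obtain ⟨b, hb⟩ := hb
    exact ⟨.comp a b, fun O n => by simp [evalo_comp, ha, hb]⟩
  | prec _ _ ha hb =>
    obtain ⟨a, ha⟩ := ha; obtain ⟨b, hb⟩ := hb
    refine ⟨.prec a b, fun O n => ?_⟩
    simp only [evalo_prec, Nat.unpaired]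
    induction n.unpair.2 with
    | zero => simp [ha]
    | succ m ih =>
      refine (congrArg (fun p : Part ℕ => p.bind fun i =>
        evalo O b (Nat.pair n.unpair.1 (Nat.pair m i))) ih).trans ?_
      simp [hb]

theorem RecIn.of_primrec {O : ℕ → ℕ} {f : ℕ → ℕ} (h : Nat.Primrec f) :
    RecIn O (fun n => Part.some (f n)) := by
  induction h with
  | zero => exact .zero
  | succ => exact .succ
  | left => exact .left
  | right => exact .right
  | pair _ _ ha hb =>
    have := RecIn.pair ha hb
    simpa [Seq.seq] using this
  | comp _ _ ha hb =>
    have := RecIn.comp ha hb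
    simpa using this
  | @prec f g _ _ ha hb =>
    have := RecIn.prec ha hb
    refine Eq.mp (congrArg (RecIn O) ?_) this
    funext n
    simp only [Nat.unpaired]
    induction n.unpair.2 with
    | zero => simp
    | succ m ih =>
      refine (congrArg (fun p : Part ℕ => p.bind fun i =>
        Part.some (g (Nat.pair n.unpair.1 (Nat.pair m i)))) ih).trans ?_
      simp

theorem UC.comp {F G : (ℕ → ℕ) → ℕ →. ℕ} (hF : UC F) (hG : UC G) :
    UC (fun O n => G O n >>= F O) := by
  obtain ⟨a, ha⟩ := hF; obtain ⟨b, hb⟩ := hG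
  refine ⟨.comp a b, fun O n => ?_⟩
  have : evalo O a = F O := funext (ha O)
  simp [evalo, this, hb]

theorem UC.pair {F G : (ℕ → ℕ) → ℕ →. ℕ} (hF : UC F) (hG : UC G) :
    UC (fun O n => Nat.pair <$> F O n <*> G O n) := by
  obtain ⟨a, ha⟩ := hF; obtain ⟨b, hb⟩ := hG
  exact ⟨.pair a b, fun O n => by simp [evalo, ha, hb]⟩

theorem UC.prec {F G : (ℕ → ℕ) → ℕ →. ℕ} (hF : UC F) (hG : UC G) :
    UC (fun O => Nat.unpaired fun a n => n.rec (F O a) fun y IH => do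
            let i ← IH
            G O (Nat.pair a (Nat.pair y i))) := by
  obtain ⟨a, ha⟩ := hF; obtain ⟨b, hb⟩ := hG
  refine ⟨.prec a b, fun O n => ?_⟩
  have h1 : evalo O a = F O := funext (ha O)
  have h2 : evalo O b = G O := funext (hb O)
  simp [evalo, h1, h2]

theorem UC.rfind {F : (ℕ → ℕ) → ℕ → ℕ} (hF : UC (fun O n => Part.some (F O n))) :
    UC (fun O a => Nat.rfind fun n => Part.some (decide (F O (Nat.pair a n) = 0))) := by
  obtain ⟨a, ha⟩ := hF
  obtain ⟨b, hb⟩ := UC.of_primrec (f := fun n => Nat.pair n 0)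
    (Nat.Primrec.pair Nat.Primrec.id Nat.Primrec.zero)
  refine ⟨.comp (.rfind' a) b, fun O n => ?_⟩
  simp only [evalo_comp, hb, Part.bind_some, evalo_rfind, ha, Part.map_some, Nat.unpair_pair,
    Nat.add_zero]
  exact Part.map_id' (fun _ => rfl) _

/-- table of an oracle -/
def table (O : ℕ → ℕ) (n : ℕ) : List ℕ := (List.range n).map O

theorem UC.table : UC (fun O n => Part.some (encode (table O n))) := by
  have hs : Nat.Primrec (fun n : ℕ =>
      encode ((Denumerable.ofNat (List ℕ) n.unpair.2.unpair.1) ++ [n.unpair.2.unpair.2])) := by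
    rw [← Primrec.nat_iff]
    refine Primrec.encode.comp (Primrec.list_append.comp ((Primrec.ofNat _).comp ?_) ?_)
    · exact Primrec.fst.comp (Primrec.unpair.comp (Primrec.snd.comp Primrec.unpair))
    · refine Primrec.list_cons.comp ?_ (Primrec.const [])
      exact Primrec.snd.comp (Primrec.unpair.comp (Primrec.snd.comp Primrec.unpair))
  obtain ⟨s, hs⟩ := UC.of_primrec hs
  obtain ⟨b, hb⟩ := UC.of_primrec (f := fun n => Nat.pair 0 n)
    (Nat.Primrec.pair Nat.Primrec.zero Nat.Primrec.id)
  -- on input pair a (pair y i): pair 0 (pair i (O y))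
  refine ⟨.comp (.prec .zero (.comp s (.pair .zero (.pair (.comp .right .right)
    (.comp .oracle (.comp .left .right)))))) b, fun O n => ?_⟩
  simp only [evalo_comp, evalo_pair, evalo_prec, hb, Part.bind_some, Nat.unpair_pair, hs]
  induction n with
  | zero => simp [_root_.table, evalo]
  | succ m ih =>
    simp only [ih]
    simp [_root_.table, List.range_succ, evalo]

theorem UC.tableWith {g : ℕ → ℕ} {h : ℕ → ℕ} (hg : Nat.Primrec g) (hh : Nat.Primrec h) :
    UC (fun O n => Part.some (g (Nat.pair (encode (_root_.table O (h n))) n))) := by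
  have := (UC.of_primrec hg).comp ((UC.table.comp (UC.of_primrec hh)).pair
    (UC.of_primrec Nat.Primrec.id))
  simpa [Seq.seq] using this

/-- evaluation with partial oracles -/
def evalp (P : ℕ → Part ℕ) : OCode → ℕ →. ℕ
  | .zero => fun _ => Part.some 0
  | .succ => fun n => Part.some (n + 1)
  | .left => fun n => Part.some (Nat.unpair n).1
  | .right => fun n => Part.some (Nat.unpair n).2
  | .oracle => P
  | .pair cf cg => fun n => Nat.pair <$> evalp P cf n <*> evalp P cg n
  | .comp cf cg => fun n => evalp P cg n >>= evalp P cf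
  | .prec cf cg =>
      Nat.unpaired fun a n =>
        n.rec (evalp P cf a) fun y IH => do
          let i ← IH
          evalp P cg (Nat.pair a (Nat.pair y i))
  | .rfind' cf =>
      Nat.unpaired fun a m =>
        (Nat.rfind fun n => (fun x => x = 0) <$> evalp P cf (Nat.pair a (n + m))).map (· + m)

theorem evalp_total (O : ℕ → ℕ) (c : OCode) : evalp (fun n => Part.some (O n)) c = evalo O c := by
  induction c <;> simp only [evalp, evalo, *] <;> rfl

theorem evalp_pair (P a b n) : evalp P (.pair a b) n =
    (evalp P a n).bind (fun x => (evalp P b n).bind fun y => Part.some (Nat.pair x y)) := by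
  simp only [evalp, Seq.seq, Part.map_eq_map, Part.bind_map, Part.bind_some_eq_map]
theorem evalp_comp (P a b n) : evalp P (.comp a b) n =
    (evalp P b n).bind (fun x => evalp P a x) := rfl
theorem evalp_prec (P a b n) : evalp P (.prec a b) n =
    Nat.rec (motive := fun _ => Part ℕ) (evalp P a n.unpair.1) (fun y IH => IH.bind fun i =>
      evalp P b (Nat.pair n.unpair.1 (Nat.pair y i))) n.unpair.2 := rfl
theorem evalp_rfind (P a n) : evalp P (.rfind' a) n =
    (Nat.rfind fun k => (evalp P a (Nat.pair n.unpair.1 (k + n.unpair.2))).map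
      (fun x => decide (x = 0))).map (· + n.unpair.2) := rfl

theorem mem_rfind' {p : ℕ → Part Bool} {n : ℕ} :
    n ∈ Nat.rfind p ↔ true ∈ p n ∧ ∀ m, m < n → false ∈ p m := by
  refine Nat.mem_rfind.trans ⟨fun h => ⟨h.1, fun m hm => h.2 hm⟩, fun h => ⟨h.1, fun hm => h.2 _ hm⟩⟩

theorem evalp_mono {P Q : ℕ → Part ℕ} (h : ∀ n v, v ∈ P n → v ∈ Q n) (c : OCode) :
    ∀ n v, v ∈ evalp P c n → v ∈ evalp Q c n := by
  induction c with
  | zero | succ | left | right => intro n v hv; exact hv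
  | oracle => exact h
  | pair a b ha hb =>
    intro n v hv
    simp only [evalp_pair, Part.mem_bind_iff, Part.mem_some_iff] at hv ⊢
    obtain ⟨x, hx, y, hy, rfl⟩ := hv
    exact ⟨x, ha _ _ hx, y, hb _ _ hy, rfl⟩
  | comp a b ha hb =>
    intro n v hv
    simp only [evalp_comp, Part.mem_bind_iff] at hv ⊢
    obtain ⟨x, hx, hy⟩ := hv
    exact ⟨x, hb _ _ hx, ha _ _ hy⟩
  | prec a b ha hb =>
    intro n
    simp only [evalp_prec]
    induction n.unpair.2 with
    | zero => intro v hv; exact ha _ _ hv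
    | succ m ih =>
      intro v hv
      simp only [Part.mem_bind_iff] at hv ⊢
      obtain ⟨x, hx, hy⟩ := hv
      exact ⟨x, ih _ hx, hb _ _ hy⟩
  | rfind' a ha =>
    intro n v hv
    simp only [evalp_rfind, Part.mem_map_iff] at hv ⊢
    simp only [mem_rfind', Part.mem_map_iff] at hv ⊢
    obtain ⟨k, ⟨⟨x, hx, hx0⟩, hlt⟩, rfl⟩ := hv
    refine ⟨k, ⟨⟨x, ha _ _ hx, hx0⟩, fun m hm => ?_⟩, rfl⟩
    obtain ⟨y, hy, hy0⟩ := hlt m hm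
    exact ⟨y, ha _ _ hy, hy0⟩

/-- continuity -/
theorem evalp_cont {P : ℕ → ℕ → Part ℕ} {Q : ℕ → Part ℕ}
    (hm : ∀ j k, j ≤ k → ∀ n v, v ∈ P j n → v ∈ P k n)
    (h : ∀ n v, v ∈ Q n → ∃ k, v ∈ P k n) (c : OCode) :
    ∀ n v, v ∈ evalp Q c n → ∃ k, v ∈ evalp (P k) c n := by
  have hmm : ∀ (c : OCode) j k, j ≤ k → ∀ n v, v ∈ evalp (P j) c n → v ∈ evalp (P k) c n :=
    fun c j k hjk => evalp_mono (hm j k hjk) c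
  induction c with
  | zero | succ | left | right => intro n v hv; exact ⟨0, hv⟩
  | oracle => exact h
  | pair a b ha hb =>
    intro n v hv
    simp only [evalp_pair, Part.mem_bind_iff, Part.mem_some_iff] at hv ⊢
    obtain ⟨x, hx, y, hy, rfl⟩ := hv
    obtain ⟨k1, h1⟩ := ha _ _ hx
    obtain ⟨k2, h2⟩ := hb _ _ hy
    exact ⟨max k1 k2, x, hmm _ _ _ (le_max_left _ _) _ _ h1, y,
      hmm _ _ _ (le_max_right _ _) _ _ h2, rfl⟩
  | comp a b ha hb =>
    intro n v hv
    simp only [evalp_comp, Part.mem_bind_iff] at hv ⊢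
    obtain ⟨x, hx, hy⟩ := hv
    obtain ⟨k1, h1⟩ := hb _ _ hx
    obtain ⟨k2, h2⟩ := ha _ _ hy
    exact ⟨max k1 k2, x, hmm _ _ _ (le_max_left _ _) _ _ h1,
      hmm _ _ _ (le_max_right _ _) _ _ h2⟩
  | prec a b ha hb =>
    intro n
    have key : ∀ j k, j ≤ k → ∀ m v, v ∈ evalp (P j) (.prec a b) (Nat.pair n.unpair.1 m) →
      v ∈ evalp (P k) (.prec a b) (Nat.pair n.unpair.1 m) := fun j k hjk m => hmm _ j k hjk _
    simp only [evalp_prec, Nat.unpair_pair] at key ⊢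
    induction n.unpair.2 with
    | zero => intro v hv; exact ha _ _ hv
    | succ m ih =>
      intro v hv
      simp only [Part.mem_bind_iff] at hv ⊢
      obtain ⟨x, hx, hy⟩ := hv
      obtain ⟨k1, h1⟩ := ih _ hx
      obtain ⟨k2, h2⟩ := hb _ _ hy
      exact ⟨max k1 k2, x, key _ _ (le_max_left _ _) _ _ h1,
        hmm _ _ _ (le_max_right _ _) _ _ h2⟩
  | rfind' a ha =>
    intro n v hv
    simp only [evalp_rfind, Part.mem_map_iff] at hv ⊢
    simp only [mem_rfind', Part.mem_map_iff] at hv ⊢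
    obtain ⟨k, ⟨⟨x, hx, hx0⟩, hlt⟩, rfl⟩ := hv
    obtain ⟨k1, h1⟩ := ha _ _ hx
    have : ∀ K, K ≤ k → ∃ k2, ∀ m, m < K → ∃ y ∈ evalp (P k2) a (Nat.pair n.unpair.1 (m + n.unpair.2)),
        decide (y = 0) = false := by
      intro K
      induction K with
      | zero => intro _; exact ⟨0, fun m hm => absurd hm (by omega)⟩
      | succ K ih =>
        intro hK
        obtain ⟨k2, h2⟩ := ih (by omega)
        obtain ⟨y, hy, hy0⟩ := hlt K (by omega)
        obtain ⟨k3, h3⟩ := ha _ _ hy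
        refine ⟨max k2 k3, fun m hm => ?_⟩
        rcases Nat.lt_succ_iff_lt_or_eq.1 hm with hm | rfl
        · obtain ⟨z, hz, hz0⟩ := h2 m hm
          exact ⟨z, hmm _ _ _ (le_max_left _ _) _ _ hz, hz0⟩
        · exact ⟨y, hmm _ _ _ (le_max_right _ _) _ _ h3, hy0⟩
    obtain ⟨k2, h2⟩ := this k le_rfl
    refine ⟨max k1 k2, k, ⟨⟨x, hmm _ _ _ (le_max_left _ _) _ _ h1, hx0⟩, fun m hm => ?_⟩, rfl⟩
    obtain ⟨y, hy, hy0⟩ := h2 m hm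
    exact ⟨y, hmm _ _ _ (le_max_right _ _) _ _ hy, hy0⟩

/-- lookup in a coded table -/
def lookup (z : ℕ) (n : ℕ) : Part ℕ := Part.ofOption ((Denumerable.ofNat (List ℕ) z)[n]?)

theorem exists_lookupCode : ∃ c : Nat.Partrec.Code, ∀ z n, c.eval (Nat.pair z n) = lookup z n := by
  have : Nat.Partrec (fun p : ℕ => lookup p.unpair.1 p.unpair.2) := by
    refine Partrec.nat_iff.1 ?_
    refine Computable.ofOption (f := fun p : ℕ =>
      (Denumerable.ofNat (List ℕ) p.unpair.1)[p.unpair.2]?) (Primrec.to_comp ?_)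
    exact Primrec.list_getElem?.comp ((Primrec.ofNat _).comp (Primrec.fst.comp Primrec.unpair))
      (Primrec.snd.comp Primrec.unpair)
  obtain ⟨c, hc⟩ := Nat.Partrec.Code.exists_code.1 this
  exact ⟨c, fun z n => by rw [hc]; simp⟩

noncomputable def lookupCode : Nat.Partrec.Code := exists_lookupCode.choose
theorem lookupCode_eval (z n : ℕ) : lookupCode.eval (Nat.pair z n) = lookup z n :=
  exists_lookupCode.choose_spec z n

namespace TT
open Nat.Partrec (Code)
open Nat.Partrec.Code

theorem ev_pair (a b n) : eval (.pair a b) n =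
    (eval a n).bind (fun x => (eval b n).bind fun y => Part.some (Nat.pair x y)) := by
  simp only [eval, Seq.seq, Part.map_eq_map, Part.bind_map, Part.bind_some_eq_map]
theorem ev_comp (a b n) : eval (.comp a b) n =
    (eval b n).bind (fun x => eval a x) := rfl
theorem ev_prec (a b n) : eval (.prec a b) n =
    Nat.rec (motive := fun _ => Part ℕ) (eval a n.unpair.1) (fun y IH => IH.bind fun i =>
      eval b (Nat.pair n.unpair.1 (Nat.pair y i))) n.unpair.2 := rfl
theorem ev_rfind (a n) : eval (.rfind' a) n =
    (Nat.rfind fun k => (eval a (Nat.pair n.unpair.1 (k + n.unpair.2))).map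
      (fun x => decide (x = 0))).map (· + n.unpair.2) := rfl
theorem ev_left (n) : eval .left n = Part.some n.unpair.1 := rfl
theorem ev_right (n) : eval .right n = Part.some n.unpair.2 := rfl
theorem ev_succ (n) : eval .succ n = Part.some (n + 1) := rfl
theorem ev_zero (n) : eval .zero n = Part.some 0 := rfl

/-- S : pair z (pair a n) ↦ pair (pair z a) n -/
def S1 : Code := .pair (.pair .left (.comp .left .right)) (.comp .right .right)
/-- pair (pair z a) k ↦ pair z (pair a k) -/
def S2 : Code := .pair (.comp .left .left) (.pair (.comp .right .left) .right)

noncomputable def T : OCode → Code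
  | .zero => .zero
  | .succ => .comp .succ .right
  | .left => .comp .left .right
  | .right => .comp .right .right
  | .oracle => lookupCode
  | .pair a b => .pair (T a) (T b)
  | .comp a b => .comp (T a) (.pair .left (T b))
  | .prec a b => .comp (.prec (T a) (.comp (T b) S2)) S1
  | .rfind' a => .comp (.rfind' (.comp (T a) S2)) S1

theorem S1_eval (z n) : S1.eval (Nat.pair z n) =
    Part.some (Nat.pair (Nat.pair z n.unpair.1) n.unpair.2) := by
  simp [S1, ev_pair, ev_comp, ev_left, ev_right]
theorem S2_eval (z a n) : S2.eval (Nat.pair (Nat.pair z a) n) =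
    Part.some (Nat.pair z (Nat.pair a n)) := by
  simp [S2, ev_pair, ev_comp, ev_left, ev_right]

theorem T_eval (c : OCode) : ∀ z n, (T c).eval (Nat.pair z n) = evalp (lookup z) c n := by
  induction c with
  | zero | succ | left | right =>
    intro z n; simp [T, ev_comp, ev_left, ev_right, ev_succ, ev_zero, evalp]
  | oracle => intro z n; exact lookupCode_eval z n
  | pair a b ha hb => intro z n; simp [T, ev_pair, evalp_pair, ha, hb]
  | comp a b ha hb =>
    intro z n
    simp [T, ev_comp, ev_pair, ev_left, evalp_comp, hb, Part.bind_assoc, ha]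
  | prec a b ha hb =>
    intro z n
    simp only [T, ev_comp, evalp_prec, S1_eval, Part.bind_some, ev_prec, Nat.unpair_pair]
    induction n.unpair.2 with
    | zero => simp [ha]
    | succ m ih =>
      refine (congrArg (fun p : Part ℕ => p.bind fun i =>
        (S2.eval (Nat.pair (Nat.pair z n.unpair.1) (Nat.pair m i))).bind fun x => (T b).eval x)
        ih).trans ?_
      simp only [S2_eval, Part.bind_some, hb]
  | rfind' a ha =>
    intro z n
    simp only [T, ev_comp, evalp_rfind, S1_eval, Part.bind_some, ev_rfind, Nat.unpair_pair,
      S2_eval, ha]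

end TT

open scoped Classical
open Encodable

/-! Part 2: indices, normal form -/
open Nat.Partrec (Code)
open TT

noncomputable def Tn (e : ℕ) : Code := T (ofNatOCode e)

theorem ofNatOCode_succ (n : ℕ) : ofNatOCode (n + 5) =
    match n.bodd, n.div2.bodd with
    | false, false => .pair (ofNatOCode n.div2.div2.unpair.1) (ofNatOCode n.div2.div2.unpair.2)
    | false, true  => .comp (ofNatOCode n.div2.div2.unpair.1) (ofNatOCode n.div2.div2.unpair.2)
    | true , false => .prec (ofNatOCode n.div2.div2.unpair.1) (ofNatOCode n.div2.div2.unpair.2)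
    | true , true  => .rfind' (ofNatOCode n.div2.div2) := by
  rw [ofNatOCode]
  all_goals (cases n.bodd <;> cases n.div2.bodd <;> rfl)

theorem Tn_succ (n : ℕ) : Tn (n + 5) =
    bif n.bodd then
      bif n.div2.bodd then .comp (.rfind' (.comp (Tn n.div2.div2) S2)) S1
      else .comp (.prec (Tn n.div2.div2.unpair.1) (.comp (Tn n.div2.div2.unpair.2) S2)) S1
    else bif n.div2.bodd then .comp (Tn n.div2.div2.unpair.1) (.pair .left (Tn n.div2.div2.unpair.2))
      else .pair (Tn n.div2.div2.unpair.1) (Tn n.div2.div2.unpair.2) := by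
  unfold Tn
  rw [ofNatOCode_succ]
  cases n.bodd <;> cases n.div2.bodd <;> rfl

theorem Tn_primrec : Primrec Tn := by
  let C0 : List Code := [Tn 0, Tn 1, Tn 2, Tn 3, Tn 4]
  let g : Unit → List Code → Option Code := fun _ l =>
    bif decide (l.length < 5) then C0[l.length]? else
    (l[(l.length-5).div2.div2.unpair.1]?).bind fun x =>
    (l[(l.length-5).div2.div2.unpair.2]?).bind fun y =>
    (l[(l.length-5).div2.div2]?).map fun w =>
      bif (l.length-5).bodd then
        bif (l.length-5).div2.bodd then .comp (.rfind' (.comp w S2)) S1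
        else .comp (.prec x (.comp y S2)) S1
      else bif (l.length-5).div2.bodd then .comp x (.pair .left y)
        else .pair x y
  have hlen : Primrec (fun p : Unit × List Code => p.2.length) := Primrec.list_length.comp Primrec.snd
  have hm : Primrec (fun p : Unit × List Code => p.2.length - 5) :=
    Primrec.nat_sub.comp hlen (Primrec.const 5)
  have hd : Primrec (fun p : Unit × List Code => (p.2.length - 5).div2) :=
    Primrec.nat_div2.comp hm
  have hdd : Primrec (fun p : Unit × List Code => (p.2.length - 5).div2.div2) :=
    Primrec.nat_div2.comp hd
  have hdd1 : Primrec (fun p : Unit × List Code => (p.2.length - 5).div2.div2.unpair.1) :=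
    Primrec.fst.comp (Primrec.unpair.comp hdd)
  have hdd2 : Primrec (fun p : Unit × List Code => (p.2.length - 5).div2.div2.unpair.2) :=
    Primrec.snd.comp (Primrec.unpair.comp hdd)
  have hg : Primrec₂ g := by
    refine Primrec.cond ?_ ?_ ?_
    · exact (PrimrecPred.decide (Primrec.nat_lt.comp hlen (Primrec.const 5)))
    · exact Primrec.list_getElem?.comp (Primrec.const C0) hlen
    refine Primrec.option_bind (Primrec.list_getElem?.comp Primrec.snd hdd1) ?_
    refine Primrec.option_bind (Primrec.list_getElem?.comp (Primrec.snd.comp Primrec.fst)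
      (hdd2.comp Primrec.fst)) ?_
    refine Primrec.option_map (Primrec.list_getElem?.comp
      (Primrec.snd.comp (Primrec.fst.comp Primrec.fst)) (hdd.comp (Primrec.fst.comp Primrec.fst))) ?_
    have h3 : Primrec (fun p : (((Unit × List Code) × Code) × Code) × Code => p.1.1.1) :=
      Primrec.fst.comp (Primrec.fst.comp Primrec.fst)
    have hx : Primrec (fun p : (((Unit × List Code) × Code) × Code) × Code => p.1.1.2) :=
      Primrec.snd.comp (Primrec.fst.comp Primrec.fst)
    have hy : Primrec (fun p : (((Unit × List Code) × Code) × Code) × Code => p.1.2) :=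
      Primrec.snd.comp Primrec.fst
    have hw : Primrec (fun p : (((Unit × List Code) × Code) × Code) × Code => p.2) := Primrec.snd
    open Nat.Partrec.Code in
    refine Primrec.cond (Primrec.nat_bodd.comp (hm.comp h3)) (Primrec.cond
      (Primrec.nat_bodd.comp (hd.comp h3)) ?_ ?_) (Primrec.cond
      (Primrec.nat_bodd.comp (hd.comp h3)) ?_ ?_)
    · exact primrec₂_comp.comp (primrec_rfind'.comp (primrec₂_comp.comp hw (Primrec.const S2)))
        (Primrec.const S1)
    · exact primrec₂_comp.comp (primrec₂_prec.comp hx (primrec₂_comp.comp hy (Primrec.const S2)))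
        (Primrec.const S1)
    · exact primrec₂_comp.comp hx (primrec₂_pair.comp (Primrec.const _) hy)
    · exact primrec₂_pair.comp hx hy
  have := Primrec.nat_strong_rec (fun (_ : Unit) n => Tn n) hg ?_
  · exact this.comp (Primrec.const ()) Primrec.id
  · intro _ n
    simp only [g, List.length_map, List.length_range]
    by_cases hn : n < 5
    · simp only [hn, decide_true, cond_true]
      interval_cases n <;> rfl
    · obtain ⟨m, rfl⟩ : ∃ m, n = m + 5 := ⟨n - 5, by omega⟩
      simp only [hn, decide_false, cond_false, Nat.add_sub_cancel]
      have h0 : m.div2.div2 < m + 5 := by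
        rw [Nat.div2_val, Nat.div2_val]; omega
      have h1 : m.div2.div2.unpair.1 < m + 5 := lt_of_le_of_lt (Nat.unpair_left_le _) h0
      have h2 : m.div2.div2.unpair.2 < m + 5 := lt_of_le_of_lt (Nat.unpair_right_le _) h0
      rw [Tn_succ]
      simp [h0, h1, h2]

/-- bounded evaluation with a coded oracle table -/
noncomputable def phi (k z e n : ℕ) : Option ℕ := Code.evaln k (Tn e) (Nat.pair z n)

theorem phi_primrec {α} [Primcodable α] {k z e n : α → ℕ} (hk : Primrec k) (hz : Primrec z)
    (he : Primrec e) (hn : Primrec n) : Primrec (fun a => phi (k a) (z a) (e a) (n a)) :=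
  Nat.Partrec.Code.primrec_evaln.comp
    (((hk.pair (Tn_primrec.comp he)).pair (Primrec₂.natPair.comp hz hn)))

theorem phi_mono {k k' z e n v : ℕ} (h : k ≤ k') (hv : v ∈ phi k z e n) : v ∈ phi k' z e n :=
  Nat.Partrec.Code.evaln_mono h hv

theorem lookup_table {O : ℕ → ℕ} {j n v : ℕ} :
    v ∈ lookup (encode (table O j)) n ↔ n < j ∧ v = O n := by
  unfold lookup
  rw [Denumerable.ofNat_encode]
  simp only [table, Part.mem_ofOption, Option.mem_def]
  by_cases h : n < j
  · simp [h, eq_comm]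
  · simp [h]

theorem phi_sound {O : ℕ → ℕ} {j k e n v : ℕ} (h : v ∈ phi k (encode (table O j)) e n) :
    v ∈ Phi O e n := by
  have h1 := Nat.Partrec.Code.evaln_sound h
  rw [Tn, T_eval] at h1
  rw [Phi, ← evalp_total]
  refine evalp_mono ?_ _ _ _ h1
  intro m w hw
  rw [lookup_table] at hw
  simp [hw.2]

theorem phi_complete {O : ℕ → ℕ} {e n v : ℕ} (h : v ∈ Phi O e n) :
    ∃ j0, ∀ j, j0 ≤ j → ∃ k0, ∀ k, k0 ≤ k → v ∈ phi k (encode (table O j)) e n := by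
  rw [Phi, ← evalp_total] at h
  have hmono : ∀ i j, i ≤ j → ∀ n v, v ∈ lookup (encode (table O i)) n →
      v ∈ lookup (encode (table O j)) n := by
    intro i j hij n v
    rw [lookup_table, lookup_table]
    exact fun h => ⟨by omega, h.2⟩
  obtain ⟨j0, h0⟩ := evalp_cont (P := fun j => lookup (encode (table O j))) hmono
    (fun n v hv => ⟨n + 1, by rw [lookup_table]; exact ⟨by omega, by simpa using hv⟩⟩) _ _ _ h
  refine ⟨j0, fun j hj => ?_⟩
  have h1 := evalp_mono (hmono j0 j hj) _ _ _ h0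
  rw [← T_eval, Nat.Partrec.Code.evaln_complete] at h1
  obtain ⟨k0, hk0⟩ := h1
  exact ⟨k0, fun k hk => Nat.Partrec.Code.evaln_mono hk hk0⟩

/-! indices -/
theorem idx_comp (a b : ℕ) : ofNatOCode (4 * Nat.pair a b + 7) =
    .comp (ofNatOCode a) (ofNatOCode b) := by
  have h1 : (4 * Nat.pair a b + 2).bodd = false := by simp [Nat.bodd_mul]
  have h2 : (4 * Nat.pair a b + 2).div2 = 2 * Nat.pair a b + 1 := by rw [Nat.div2_val]; omega
  have h3 : (2 * Nat.pair a b + 1).bodd = true := by simp [Nat.bodd_mul]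
  have h4 : (2 * Nat.pair a b + 1).div2 = Nat.pair a b := by rw [Nat.div2_val]; omega
  have := ofNatOCode_succ (4 * Nat.pair a b + 2)
  simp only [h1, h2, h3, h4, Nat.unpair_pair] at this
  exact this

theorem idx_pair (a b : ℕ) : ofNatOCode (4 * Nat.pair a b + 5) =
    .pair (ofNatOCode a) (ofNatOCode b) := by
  have h1 : (4 * Nat.pair a b).bodd = false := by simp [Nat.bodd_mul]
  have h2 : (4 * Nat.pair a b).div2 = 2 * Nat.pair a b := by rw [Nat.div2_val]; omega
  have h3 : (2 * Nat.pair a b).bodd = false := by simp [Nat.bodd_mul]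
  have h4 : (2 * Nat.pair a b).div2 = Nat.pair a b := by rw [Nat.div2_val]; omega
  have := ofNatOCode_succ (4 * Nat.pair a b)
  simp only [h1, h2, h3, h4, Nat.unpair_pair] at this
  exact this

theorem idx_prec (a b : ℕ) : ofNatOCode (4 * Nat.pair a b + 6) =
    .prec (ofNatOCode a) (ofNatOCode b) := by
  have h1 : (4 * Nat.pair a b + 1).bodd = true := by simp [Nat.bodd_mul]
  have h2 : (4 * Nat.pair a b + 1).div2 = 2 * Nat.pair a b := by rw [Nat.div2_val]; omega
  have h3 : (2 * Nat.pair a b).bodd = false := by simp [Nat.bodd_mul]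
  have h4 : (2 * Nat.pair a b).div2 = Nat.pair a b := by rw [Nat.div2_val]; omega
  have := ofNatOCode_succ (4 * Nat.pair a b + 1)
  simp only [h1, h2, h3, h4, Nat.unpair_pair] at this
  exact this

theorem idx_rfind (a : ℕ) : ofNatOCode (4 * a + 8) = .rfind' (ofNatOCode a) := by
  have h1 : (4 * a + 3).bodd = true := by simp [Nat.bodd_mul]
  have h2 : (4 * a + 3).div2 = 2 * a + 1 := by rw [Nat.div2_val]; omega
  have h3 : (2 * a + 1).bodd = true := by simp [Nat.bodd_mul]
  have h4 : (2 * a + 1).div2 = a := by rw [Nat.div2_val]; omega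
  have := ofNatOCode_succ (4 * a + 3)
  simp only [h1, h2, h3, h4] at this
  exact this

theorem ofNatOCode_surj (c : OCode) : ∃ n, ofNatOCode n = c := by
  induction c with
  | zero => exact ⟨0, by rw [ofNatOCode]⟩
  | succ => exact ⟨1, by rw [ofNatOCode]⟩
  | left => exact ⟨2, by rw [ofNatOCode]⟩
  | right => exact ⟨3, by rw [ofNatOCode]⟩
  | oracle => exact ⟨4, by rw [ofNatOCode]⟩
  | pair _ _ ha hb => obtain ⟨a, rfl⟩ := ha; obtain ⟨b, rfl⟩ := hb; exact ⟨_, idx_pair a b⟩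
  | comp _ _ ha hb => obtain ⟨a, rfl⟩ := ha; obtain ⟨b, rfl⟩ := hb; exact ⟨_, idx_comp a b⟩
  | prec _ _ ha hb => obtain ⟨a, rfl⟩ := ha; obtain ⟨b, rfl⟩ := hb; exact ⟨_, idx_prec a b⟩
  | rfind' _ ha => obtain ⟨a, rfl⟩ := ha; exact ⟨_, idx_rfind a⟩

theorem UC.index {F : (ℕ → ℕ) → ℕ →. ℕ} (h : UC F) : ∃ e, ∀ O n, Phi O e n = F O n := by
  obtain ⟨c, hc⟩ := h
  obtain ⟨e, rfl⟩ := ofNatOCode_surj c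
  exact ⟨e, hc⟩

/-- index of the constant function -/
def cidx : ℕ → ℕ
  | 0 => 0
  | n + 1 => 4 * Nat.pair 1 (cidx n) + 7

theorem cidx_eval (O : ℕ → ℕ) (x n : ℕ) : evalo O (ofNatOCode (cidx x)) n = Part.some x := by
  induction x with
  | zero => rw [cidx, ofNatOCode]; rfl
  | succ x ih =>
    rw [cidx, idx_comp, evalo_comp, ih, Part.bind_some, ofNatOCode]; rfl

theorem cidx_primrec : Primrec cidx := by
  have := Primrec.nat_rec₁ (f := fun _ r => 4 * Nat.pair 1 r + 7) 0
    (Primrec.nat_add.comp (Primrec.nat_mul.comp (Primrec.const 4)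
      (Primrec₂.natPair.comp (Primrec.const 1) Primrec.snd)) (Primrec.const 7))
  refine this.of_eq fun n => ?_
  induction n with
  | zero => rfl
  | succ n ih => simp only [cidx]; rw [← ih]

/-- index of `y ↦ Φ_c (x)` -/
def aidx (c x : ℕ) : ℕ := 4 * Nat.pair c (cidx x) + 7
theorem aidx_eval (O : ℕ → ℕ) (c x n : ℕ) : Phi O (aidx c x) n = Phi O c x := by
  rw [Phi, aidx, idx_comp, evalo_comp, cidx_eval, Part.bind_some]; rfl
theorem aidx_primrec (c : ℕ) : Primrec (aidx c) :=
  Primrec.nat_add.comp (Primrec.nat_mul.comp (Primrec.const 4)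
      (Primrec₂.natPair.comp (Primrec.const c) cidx_primrec)) (Primrec.const 7)

/-- index of `y ↦ Φ_c (x, y)` -/
def sidx (c x : ℕ) : ℕ := 4 * Nat.pair c (4 * Nat.pair (cidx x) (4 * Nat.pair 2 3 + 5) + 5) + 7
theorem sidx_eval (O : ℕ → ℕ) (c x n : ℕ) : Phi O (sidx c x) n = Phi O c (Nat.pair x n) := by
  rw [Phi, sidx, idx_comp, evalo_comp, idx_pair, evalo_pair, cidx_eval, Part.bind_some, idx_pair,
    evalo_pair, ofNatOCode, ofNatOCode]
  simp [evalo, Phi]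
theorem sidx_primrec (c : ℕ) : Primrec (sidx c) :=
  Primrec.nat_add.comp (Primrec.nat_mul.comp (Primrec.const 4)
      (Primrec₂.natPair.comp (Primrec.const c) (Primrec.nat_add.comp (Primrec.nat_mul.comp
        (Primrec.const 4) (Primrec₂.natPair.comp cidx_primrec (Primrec.const _))) (Primrec.const 5))))
      (Primrec.const 7)

open scoped Classical
open Encodable

/-! Part 3: combinatorics of measure -/

def strs : ℕ → List (List Bool)
  | 0 => [[]]
  | n + 1 => (strs n).map (List.cons false) ++ (strs n).map (List.cons true)

noncomputable def num (t : ℕ) (p : List Bool → Prop) : ℕ := (strs t).countP (fun ρ => decide (p ρ))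

theorem num_zero (p : List Bool → Prop) : num 0 p = if p [] then 1 else 0 := by
  by_cases h : p [] <;> simp [num, strs, h]

theorem num_succ (t : ℕ) (p : List Bool → Prop) :
    num (t + 1) p = num t (fun ρ => p (false :: ρ)) + num t (fun ρ => p (true :: ρ)) := by
  simp [num, strs, List.countP_append, List.countP_map, Function.comp_def]

theorem mem_strs {t : ℕ} {ρ : List Bool} : ρ ∈ strs t ↔ ρ.length = t := by
  induction t generalizing ρ with
  | zero => simp [strs]
  | succ t ih =>
    cases ρ with
    | nil => simp [strs]
    | cons b ρ => cases b <;> simp [strs, ih]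

theorem strs_length (t : ℕ) : (strs t).length = 2 ^ t := by
  induction t with
  | zero => rfl
  | succ t ih => simp [strs, ih]; ring

theorem num_le (t : ℕ) (p : List Bool → Prop) : num t p ≤ 2 ^ t := by
  rw [← strs_length]; exact List.countP_le_length

theorem num_mono {t : ℕ} {p q : List Bool → Prop} (h : ∀ ρ, ρ.length = t → p ρ → q ρ) :
    num t p ≤ num t q := by
  apply List.countP_mono_left
  intro ρ hρ
  simpa using h ρ (mem_strs.1 hρ)

theorem num_true {t : ℕ} {p : List Bool → Prop} (h : ∀ ρ, ρ.length = t → p ρ) :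
    num t p = 2 ^ t := by
  rw [← strs_length, num, List.countP_eq_length]
  intro ρ hρ
  simpa using h ρ (mem_strs.1 hρ)

theorem num_eq_zero {t : ℕ} {p : List Bool → Prop} (h : ∀ ρ, ρ.length = t → ¬ p ρ) :
    num t p = 0 := by
  rw [num, List.countP_eq_zero]
  intro ρ hρ
  simpa using h ρ (mem_strs.1 hρ)

theorem num_or (t : ℕ) (p q : List Bool → Prop) :
    num t (fun ρ => p ρ ∨ q ρ) ≤ num t p + num t q := by
  induction t generalizing p q with
  | zero => simp only [num_zero]; split_ifs <;> simp_all
  | succ t ih =>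
    have h1 := ih (fun ρ => p (false :: ρ)) (fun ρ => q (false :: ρ))
    have h2 := ih (fun ρ => p (true :: ρ)) (fun ρ => q (true :: ρ))
    simp only [num_succ]
    linarith

/-- number of extensions by `t` bits lying in `A` -/
noncomputable def cnt (A : List Bool → Prop) (τ : List Bool) (t : ℕ) : ℕ := num t (fun ρ => A (τ ++ ρ))

theorem cnt_succ (A : List Bool → Prop) (τ : List Bool) (t : ℕ) :
    cnt A τ (t + 1) = cnt A (τ ++ [false]) t + cnt A (τ ++ [true]) t := by
  simp [cnt, num_succ]

theorem cnt_le (A : List Bool → Prop) (τ : List Bool) (t : ℕ) : cnt A τ t ≤ 2 ^ t := num_le _ _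

def Up (A : List Bool → Prop) : Prop := ∀ σ ρ, A σ → A (σ ++ ρ)

theorem cnt_step {A : List Bool → Prop} (hA : Up A) (τ : List Bool) (t : ℕ) :
    2 * cnt A τ t ≤ cnt A τ (t + 1) := by
  induction t generalizing τ with
  | zero =>
    rw [cnt_succ]
    simp only [cnt, num_zero, List.append_nil]
    by_cases h : A τ
    · simp [h, hA _ [false] h, hA _ [true] h]
    · simp [h]
  | succ t ih =>
    rw [cnt_succ A τ (t+1), cnt_succ A τ t]
    linarith [ih (τ ++ [false]), ih (τ ++ [true])]

theorem cnt_add {A : List Bool → Prop} (hA : Up A) (τ : List Bool) (t u : ℕ) :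
    2 ^ u * cnt A τ t ≤ cnt A τ (t + u) := by
  induction u with
  | zero => simp
  | succ u ih => rw [← Nat.add_assoc, pow_succ]; linarith [cnt_step hA τ (t + u)]

theorem cnt_full {A : List Bool → Prop} (hA : Up A) {τ : List Bool} (h : A τ) (t : ℕ) :
    cnt A τ t = 2 ^ t := num_true fun ρ _ => hA _ _ h

/-- density at least `2^{-a}` at some level -/
def QQ (A : List Bool → Prop) (τ : List Bool) (a : ℕ) : Prop := ∃ t, 2 ^ t ≤ 2 ^ a * cnt A τ t

/-- splitting of counts. -/
theorem cnt_split {A : List Bool → Prop} (hA : Up A) (a u t : ℕ) (σ : List Bool) :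
    2 ^ a * 2 ^ u * cnt A σ t + 2 ^ u * num t (fun ρ => ¬ A (σ ++ ρ) ∧ 2 ^ u ≤ 2 ^ a * cnt A (σ ++ ρ) u)
      ≤ 2 ^ a * cnt A σ (t + u) := by
  induction t generalizing σ with
  | zero =>
    simp only [cnt, num_zero, List.append_nil, Nat.zero_add]
    by_cases h : A σ
    · have : num u (fun ρ => A (σ ++ ρ)) = 2 ^ u := cnt_full hA h u
      simp [h, this]
    · simp only [h, if_false, not_false_eq_true, true_and]
      split_ifs with h2
      · simpa using h2
      · simp
  | succ t ih =>
    have e : t + 1 + u = (t + u) + 1 := by ring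
    rw [e, cnt_succ, cnt_succ, num_succ]
    have h1 := ih (σ ++ [false])
    have h2 := ih (σ ++ [true])
    simp only [List.append_assoc, List.singleton_append] at h1 h2
    ring_nf at h1 h2 ⊢
    linarith

theorem QQ_lift {A : List Bool → Prop} (hA : Up A) {τ : List Bool} {a t : ℕ}
    (h : 2 ^ t ≤ 2 ^ a * cnt A τ t) {u : ℕ} (hu : t ≤ u) : 2 ^ u ≤ 2 ^ a * cnt A τ u := by
  obtain ⟨v, rfl⟩ := Nat.exists_eq_add_of_le hu
  calc 2 ^ (t + v) = 2 ^ v * 2 ^ t := by ring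
    _ ≤ 2 ^ v * (2 ^ a * cnt A τ t) := Nat.mul_le_mul_left _ h
    _ = 2 ^ a * (2 ^ v * cnt A τ t) := by ring
    _ ≤ _ := Nat.mul_le_mul_left _ (cnt_add hA τ t v)

theorem leak {A : List Bool → Prop} (hA : Up A) (σ : List Bool) (a N : ℕ) :
    ∃ t0, ∀ t, t0 ≤ t →
      2 ^ N * num t (fun ρ => ¬ A (σ ++ ρ) ∧ QQ A (σ ++ ρ) a) ≤ 2 ^ t := by
  -- the densities form a bounded monotone sequence
  let d : ℕ → ℝ := fun t => cnt A σ t / 2 ^ t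
  have hmono : Monotone d := by
    refine monotone_nat_of_le_succ fun t => ?_
    simp only [d]
    rw [div_le_div_iff₀ (by positivity) (by positivity), pow_succ]
    have : (2 * cnt A σ t : ℝ) ≤ cnt A σ (t + 1) := by exact_mod_cast cnt_step hA σ t
    have h2 : (0:ℝ) < 2 ^ t := by positivity
    nlinarith
  have hbdd : BddAbove (Set.range d) := by
    refine ⟨1, ?_⟩
    rintro _ ⟨t, rfl⟩
    simp only [d]
    rw [div_le_one (by positivity)]
    exact_mod_cast cnt_le A σ t
  have hlim := tendsto_atTop_ciSup hmono hbdd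
  set s := ⨆ i, d i
  have hδ : (0:ℝ) < 1 / (2 ^ a * 2 ^ N) := by positivity
  obtain ⟨t0, ht0⟩ := (hlim.eventually (lt_mem_nhds (show s - 1 / (2 ^ a * 2 ^ N) < s by linarith))).exists
  refine ⟨t0, fun t ht => ?_⟩
  -- common level
  obtain ⟨u, hu⟩ : ∃ u, ∀ ρ ∈ strs t, QQ A (σ ++ ρ) a → 2 ^ u ≤ 2 ^ a * cnt A (σ ++ ρ) u := by
    induction strs t with
    | nil => exact ⟨0, by simp⟩
    | cons ρ l ih =>
      obtain ⟨u, hu⟩ := ih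
      by_cases h : QQ A (σ ++ ρ) a
      · obtain ⟨v, hv⟩ := h
        refine ⟨max u v, ?_⟩
        intro ρ' h' hq
        rcases List.mem_cons.1 h' with rfl | h'
        · exact QQ_lift hA hv (le_max_right _ _)
        · exact QQ_lift hA (hu _ h' hq) (le_max_left _ _)
      · refine ⟨u, ?_⟩
        intro ρ' h' hq
        rcases List.mem_cons.1 h' with rfl | h'
        · exact absurd hq h
        · exact hu _ h' hq
  have h1 : num t (fun ρ => ¬ A (σ ++ ρ) ∧ QQ A (σ ++ ρ) a) ≤
      num t (fun ρ => ¬ A (σ ++ ρ) ∧ 2 ^ u ≤ 2 ^ a * cnt A (σ ++ ρ) u) :=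
    num_mono fun ρ hρ h => ⟨h.1, hu ρ (mem_strs.2 hρ) h.2⟩
  have h2 := cnt_split hA a u t σ
  have h3 : d (t + u) ≤ s := le_ciSup hbdd _
  have h4 : d t0 ≤ d t := hmono ht
  have h5 : d (t + u) - d t < 1 / (2 ^ a * 2 ^ N) := by linarith
  set x := num t (fun ρ => ¬ A (σ ++ ρ) ∧ 2 ^ u ≤ 2 ^ a * cnt A (σ ++ ρ) u)
  have h2' : (2 ^ a * 2 ^ u * cnt A σ t + 2 ^ u * x : ℝ) ≤ 2 ^ a * cnt A σ (t + u) := by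
    exact_mod_cast h2
  have e1 : (cnt A σ t : ℝ) = d t * 2 ^ t := by simp [d]
  have e2 : (cnt A σ (t + u) : ℝ) = d (t + u) * (2 ^ t * 2 ^ u) := by simp [d, pow_add]
  rw [e1, e2] at h2'
  have p1 : (0:ℝ) < 2 ^ u := by positivity
  have p2 : (0:ℝ) < 2 ^ t := by positivity
  have p3 : (0:ℝ) < 2 ^ a := by positivity
  have p4 : (0:ℝ) < 2 ^ N := by positivity
  have h6 : (x : ℝ) ≤ 2 ^ a * 2 ^ t * (d (t + u) - d t) := by
    have : 2 ^ u * (x : ℝ) ≤ 2 ^ u * (2 ^ a * 2 ^ t * (d (t + u) - d t)) := by linarith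
    exact le_of_mul_le_mul_left this p1
  have h7 : 2 ^ N * (x : ℝ) ≤ 2 ^ t := by
    rw [lt_div_iff₀ (by positivity)] at h5
    calc 2 ^ N * (x : ℝ) ≤ 2 ^ N * (2 ^ a * 2 ^ t * (d (t + u) - d t)) := by gcongr
      _ = 2 ^ t * ((d (t + u) - d t) * (2 ^ a * 2 ^ N)) := by ring
      _ ≤ 2 ^ t * 1 := by gcongr
      _ = _ := by ring
  have h8 : 2 ^ N * x ≤ 2 ^ t := by exact_mod_cast h7
  exact le_trans (Nat.mul_le_mul_left _ h1) h8

/-- Kolmogorov inequality -/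
theorem kolm {M : List Bool → ℚ} (hM : IsMartingale M) {b : ℚ} (hb : 0 ≤ b) (t : ℕ) (σ : List Bool) :
    b * num t (fun ρ => ∃ k, k ≤ ρ.length ∧ b < M (σ ++ ρ.take k)) ≤ 2 ^ t * M σ := by
  induction t generalizing σ with
  | zero =>
    rw [num_zero]
    simp only [List.length_nil, List.take_nil, List.append_nil]
    split_ifs with h
    · obtain ⟨_, _, h⟩ := h; simp; linarith
    · simpa using hM.1 σ
  | succ t ih =>
    by_cases h : b < M σ
    · have h1 := num_le (t+1) (fun ρ => ∃ k, k ≤ ρ.length ∧ b < M (σ ++ ρ.take k))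
      have h2 : (num (t+1) (fun ρ => ∃ k, k ≤ ρ.length ∧ b < M (σ ++ ρ.take k)) : ℚ) ≤ 2 ^ (t+1) := by
        exact_mod_cast h1
      calc _ ≤ b * 2 ^ (t+1) := by gcongr
        _ ≤ M σ * 2 ^ (t+1) := by gcongr
        _ = _ := by ring
    · rw [num_succ]
      have key : ∀ c : Bool, num t (fun ρ => ∃ k, k ≤ (c :: ρ).length ∧ b < M (σ ++ (c :: ρ).take k))
          ≤ num t (fun ρ => ∃ k, k ≤ ρ.length ∧ b < M ((σ ++ [c]) ++ ρ.take k)) := by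
        intro c
        refine num_mono fun ρ _ => ?_
        rintro ⟨k, hk, hk2⟩
        cases k with
        | zero => simp at hk2; exact absurd hk2 (by simpa using h)
        | succ k => exact ⟨k, by simpa using hk, by simpa using hk2⟩
      have k1 : (num t (fun ρ => ∃ k, k ≤ (false :: ρ).length ∧ b < M (σ ++ (false :: ρ).take k)) : ℚ)
        ≤ num t (fun ρ => ∃ k, k ≤ ρ.length ∧ b < M ((σ ++ [false]) ++ ρ.take k)) := by
        exact_mod_cast key false
      have k2 : (num t (fun ρ => ∃ k, k ≤ (true :: ρ).length ∧ b < M (σ ++ (true :: ρ).take k)) : ℚ)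
        ≤ num t (fun ρ => ∃ k, k ≤ ρ.length ∧ b < M ((σ ++ [true]) ++ ρ.take k)) := by
        exact_mod_cast key true
      have := hM.2 σ
      push_cast
      have k3 := mul_le_mul_of_nonneg_left k1 hb
      have k4 := mul_le_mul_of_nonneg_left k2 hb
      have i1 := ih (σ ++ [false])
      have i2 := ih (σ ++ [true])
      have e : (2:ℚ) ^ (t+1) * M σ = 2 ^ t * M (σ ++ [false]) + 2 ^ t * M (σ ++ [true]) := by
        rw [← mul_add, ← this]; ring
      rw [e, mul_add]
      linarith

/-- the bound at stage `s` -/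
def bnd (m : ℚ) (s : ℕ) : ℚ := m * (2 - 1 / 2 ^ s)

theorem exists_ext {M : List Bool → ℚ} (hM : IsMartingale M) {m : ℚ} (hm : 0 < m) (s : ℕ)
    {σ : List Bool} (hσ : ∀ k, k ≤ σ.length → M (σ.take k) ≤ bnd m s)
    {W V U : List Bool → Prop} (hW : Up W) (hV : Up V) (hVU : ∀ τ, V τ ↔ U τ ∨ W τ)
    (hd : ¬ QQ W σ (s + 4)) (a : ℕ) :
    ∃ ρ, ρ.length ≠ 0 ∧ (∀ k, k ≤ (σ ++ ρ).length → M ((σ ++ ρ).take k) ≤ bnd m (s + 1)) ∧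
      (¬ QQ V (σ ++ ρ) a ∨ (¬ QQ W (σ ++ ρ) a ∧ U (σ ++ ρ))) := by
  obtain ⟨t1, h1⟩ := leak hW σ a (s + 5)
  obtain ⟨t2, h2⟩ := leak hV σ a (s + 5)
  obtain ⟨t, ht1, ht2, ht3⟩ : ∃ t, t1 ≤ t ∧ t2 ≤ t ∧ t ≠ 0 :=
    ⟨max t1 t2 + 1, by omega, by omega, by omega⟩
  have h1 := h1 t ht1
  have h2 := h2 t ht2
  by_contra hcon
  push Not at hcon
  have h2s : (1:ℚ) ≤ 2 ^ s := one_le_pow₀ (by norm_num)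
  have hb0 : 0 < bnd m (s+1) := by
    unfold bnd
    have : (1:ℚ) / 2 ^ (s+1) ≤ 1 := by
      rw [div_le_one (by positivity)]; exact one_le_pow₀ (by norm_num)
    apply mul_pos hm; linarith
  have hb1 : bnd m s ≤ bnd m (s+1) := by
    unfold bnd
    have : (1:ℚ) / 2 ^ (s+1) ≤ 1 / 2 ^ s := by
      apply one_div_le_one_div_of_le (by positivity); rw [pow_succ]; linarith
    gcongr
  have h3 := kolm hM hb0.le t σ
  have hσ0 : M σ ≤ bnd m s := by simpa using hσ σ.length le_rfl
  set A := fun ρ : List Bool => ∃ k, k ≤ ρ.length ∧ bnd m (s+1) < M (σ ++ ρ.take k)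
  set B := fun ρ : List Bool => W (σ ++ ρ)
  set C := fun ρ : List Bool => ¬ W (σ ++ ρ) ∧ QQ W (σ ++ ρ) a
  set D := fun ρ : List Bool => ¬ V (σ ++ ρ) ∧ QQ V (σ ++ ρ) a
  have hall : num t (fun ρ => (A ρ ∨ B ρ) ∨ (C ρ ∨ D ρ)) = 2 ^ t := by
    refine num_true fun ρ hρ => ?_
    by_contra hno
    simp only [A, B, C, D] at hno
    push Not at hno
    obtain ⟨⟨hA, hB⟩, hC, hD⟩ := hno
    have hpre : ∀ k, k ≤ (σ ++ ρ).length → M ((σ ++ ρ).take k) ≤ bnd m (s + 1) := by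
      intro k hk
      rcases le_total k σ.length with h | h
      · rw [List.take_append_of_le_length h]
        exact (hσ k h).trans hb1
      · obtain ⟨j, rfl⟩ := Nat.exists_eq_add_of_le h
        rw [List.take_append, List.take_of_length_le (by omega), Nat.add_sub_cancel_left]
        exact hA j (by simpa using hk)
    have := hcon ρ (by omega) hpre
    by_cases hv : V (σ ++ ρ)
    · rcases (hVU _).1 hv with hu | hw
      · exact this.2 (hC hB) hu
      · exact hB hw
    · exact hD hv this.1
  have hsum : 2 ^ t ≤ (num t A + num t B) + (num t C + num t D) := by
    rw [← hall]
    exact (num_or _ _ _).trans (Nat.add_le_add (num_or _ _ _) (num_or _ _ _))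
  have hB : 2 ^ (s+4) * num t B < 2 ^ t := by
    by_contra h
    exact hd ⟨t, not_lt.1 h⟩
  have hsum' : (2 ^ t : ℚ) ≤ (num t A + num t B) + (num t C + num t D) := by exact_mod_cast hsum
  have hB' : (2 ^ (s+4) * num t B : ℚ) < 2 ^ t := by exact_mod_cast hB
  have hC' : (2 ^ (s+5) * num t C : ℚ) ≤ 2 ^ t := by exact_mod_cast h1
  have hD' : (2 ^ (s+5) * num t D : ℚ) ≤ 2 ^ t := by exact_mod_cast h2
  have hA' : bnd m (s+1) * num t A ≤ 2 ^ t * bnd m s := by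
    refine h3.trans ?_; gcongr
  -- cancel `m`
  have hA2 : (2 * 2 ^ (s+1) - 1) * (num t A : ℚ) ≤ 2 ^ t * (2 * 2 ^ (s+1) - 2) := by
    unfold bnd at hA'
    have e1 : m * (2 - 1 / 2 ^ (s+1)) * (num t A : ℚ) = (m / 2 ^ (s+1)) * ((2 * 2 ^ (s+1) - 1) * num t A) := by
      field_simp
    have e2 : 2 ^ t * (m * (2 - 1 / 2 ^ s)) = (m / 2 ^ (s+1)) * (2 ^ t * (2 * 2 ^ (s+1) - 2)) := by
      rw [pow_succ 2 s]; field_simp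
    rw [e1, e2] at hA'
    exact le_of_mul_le_mul_left hA' (by positivity)
  rw [pow_add] at hB' hC' hD'
  rw [pow_succ] at hA2
  set y : ℚ := 2 ^ s
  set z : ℚ := 2 ^ t
  have hz : 0 < z := by positivity
  -- A ≤ z (1 - 1/(4y-1)),  B < z/(16y), C,D ≤ z/(32 y)
  have hA3 : (4 * y - 1) * (z - num t A) ≥ z := by linarith
  have hA4 : 4 * y * (z - num t A) ≥ z := by
    have : 0 ≤ z - num t A := by
      by_contra hneg
      push Not at hneg
      nlinarith
    nlinarith
  have hs1 : 4 * y * (z - num t A) ≤ 4 * y * (num t B + (num t C + num t D)) := by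
    apply mul_le_mul_of_nonneg_left _ (by positivity); linarith
  norm_num at hB' hC' hD'
  linarith

open scoped Classical
open Encodable
open Nat.Partrec (Code)

/-! Part 4: the query machine -/

section prims
variable {α β : Type} [Primcodable α] [Primcodable β]

theorem pp_exists_lt {f : α → ℕ} {R : α → ℕ → Prop} (hf : Primrec f)
    (hR : PrimrecPred fun p : α × ℕ => R p.1 p.2) : PrimrecPred fun a => ∃ x < f a, R a x := by
  have h : PrimrecRel fun (x : ℕ) (a : α) => R a x :=
    (hR.comp (Primrec.pair Primrec.snd Primrec.fst) : PrimrecPred fun p : ℕ × α => R p.2 p.1).primrecRel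
  exact (h.exists_mem_list.comp (Primrec.list_range.comp hf) Primrec.id).of_eq (by simp)

theorem pp_forall_lt {f : α → ℕ} {R : α → ℕ → Prop} (hf : Primrec f)
    (hR : PrimrecPred fun p : α × ℕ => R p.1 p.2) : PrimrecPred fun a => ∀ x < f a, R a x := by
  have h : PrimrecRel fun (x : ℕ) (a : α) => R a x :=
    (hR.comp (Primrec.pair Primrec.snd Primrec.fst) : PrimrecPred fun p : ℕ × α => R p.2 p.1).primrecRel
  exact (h.forall_mem_list.comp (Primrec.list_range.comp hf) Primrec.id).of_eq (by simp)

theorem pp_exists_mem {f : α → List β} {R : α → β → Prop} (hf : Primrec f)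
    (hR : PrimrecPred fun p : α × β => R p.1 p.2) : PrimrecPred fun a => ∃ x ∈ f a, R a x := by
  have h : PrimrecRel fun (x : β) (a : α) => R a x :=
    (hR.comp (Primrec.pair Primrec.snd Primrec.fst) : PrimrecPred fun p : β × α => R p.2 p.1).primrecRel
  exact h.exists_mem_list.comp hf Primrec.id

theorem pr_countP {f : α → List β} {R : α → β → Prop} (hf : Primrec f)
    (hR : PrimrecPred fun p : α × β => R p.1 p.2) :
    Primrec fun a => (f a).countP (fun x => decide (R a x)) := by
  have h : PrimrecRel fun (x : β) (a : α) => R a x :=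
    (hR.comp (Primrec.pair Primrec.snd Primrec.fst) : PrimrecPred fun p : β × α => R p.2 p.1).primrecRel
  have := Primrec.list_length.comp (h.listFilter.comp hf Primrec.id)
  refine this.of_eq fun a => ?_
  rw [List.countP_eq_length_filter]; simp

theorem pr_pow2 {f : α → ℕ} (hf : Primrec f) : Primrec fun a => 2 ^ f a := by
  have h := (Primrec.nat_iff.2 Nat.Primrec.pow).comp (Primrec₂.natPair.comp (Primrec.const 2) hf)
  refine h.of_eq fun a => by simp [Nat.unpaired]

theorem pp_isSome {f : α → Option ℕ} (hf : Primrec f) : PrimrecPred fun a => (f a).isSome = true :=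
  Primrec.eq.comp (Primrec.option_isSome.comp hf) (Primrec.const true)
end prims

theorem strs_primrec : Primrec strs := by
  have := Primrec.nat_rec₁ (f := fun _ (r : List (List Bool)) =>
      r.map (List.cons false) ++ r.map (List.cons true)) [[]]
    (Primrec.list_append.comp
      (Primrec.list_map Primrec.snd (Primrec.list_cons.comp (Primrec.const false) Primrec.snd))
      (Primrec.list_map Primrec.snd (Primrec.list_cons.comp (Primrec.const true) Primrec.snd)))
  refine this.of_eq fun n => ?_
  induction n with
  | zero => rfl
  | succ n ih => rw [strs, ← ih]

/-- joint table -/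
def jt (l : List ℕ) (τ : List Bool) (j : ℕ) : List ℕ :=
  (List.range (2 * j)).map fun m =>
    if m % 2 = 0 then l.getD (m / 2) 0 else (bif τ.getD (m / 2) false then 1 else 0)

theorem jt_congr {l l' : List ℕ} {τ τ' : List Bool} {j : ℕ}
    (h1 : ∀ m, m < j → l.getD m 0 = l'.getD m 0) (h2 : ∀ m, m < j → τ.getD m false = τ'.getD m false) :
    jt l τ j = jt l' τ' j := by
  unfold jt
  apply List.map_congr_left
  intro m hm
  have : m / 2 < j := by have := List.mem_range.1 hm; omega
  rw [h1 _ this, h2 _ this]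

theorem jt_primrec {α : Type} [Primcodable α] {l : α → List ℕ} {τ : α → List Bool} {j : α → ℕ}
    (hl : Primrec l) (hτ : Primrec τ) (hj : Primrec j) : Primrec fun a => jt (l a) (τ a) (j a) := by
  refine Primrec.list_map (Primrec.list_range.comp (Primrec.nat_mul.comp (Primrec.const 2) hj)) ?_
  have hd : Primrec fun p : α × ℕ => p.2 / 2 := Primrec.nat_div.comp Primrec.snd (Primrec.const 2)
  refine Primrec.ite (Primrec.eq.comp (Primrec.nat_mod.comp Primrec.snd (Primrec.const 2)) (Primrec.const 0))
    ((Primrec.list_getD 0).comp (hl.comp Primrec.fst) hd)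
    (Primrec.cond ((Primrec.list_getD false).comp (hτ.comp Primrec.fst) hd) (Primrec.const 1) (Primrec.const 0))

def Ul (l : List ℕ) (s : ℕ) (τ : List Bool) : Prop :=
  ∃ j < τ.length + 1, (phi τ.length (encode (jt l τ j)) s s).isSome = true

theorem Ul_primrec {α : Type} [Primcodable α] {l : α → List ℕ} {s : α → ℕ} {τ : α → List Bool}
    (hl : Primrec l) (hs : Primrec s) (hτ : Primrec τ) : PrimrecPred fun a => Ul (l a) (s a) (τ a) := by
  refine pp_exists_lt (Primrec.succ.comp (Primrec.list_length.comp hτ)) (pp_isSome ?_)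
  exact phi_primrec (Primrec.list_length.comp (hτ.comp Primrec.fst))
    (Primrec.encode.comp (jt_primrec (hl.comp Primrec.fst) (hτ.comp Primrec.fst) Primrec.snd))
    (hs.comp Primrec.fst) (hs.comp Primrec.fst)

/-- the open set of `τ` forcing `s` into the jump -/
def UU (O : ℕ → ℕ) (s : ℕ) (τ : List Bool) : Prop := Ul (table O τ.length) s τ

def WW (O : ℕ → ℕ) (J : List ℕ) (τ : List Bool) : Prop := ∃ s ∈ J, UU O s τ

theorem table_getD (O : ℕ → ℕ) {n m : ℕ} (h : m < n) : (table O n).getD m 0 = O m := by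
  simp [table, List.getD, h]

theorem UU_up (O : ℕ → ℕ) (s : ℕ) : Up (UU O s) := by
  rintro σ ρ ⟨j, hj, h⟩
  refine ⟨j, by simp; omega, ?_⟩
  obtain ⟨v, hv⟩ := Option.isSome_iff_exists.1 h
  have e : jt (table O (σ ++ ρ).length) (σ ++ ρ) j = jt (table O σ.length) σ j := by
    apply jt_congr
    · intro m hm
      rw [table_getD _ (by simp; omega), table_getD _ (by omega)]
    · intro m hm
      simp only [List.getD]
      rw [List.getElem?_append_left (by omega)]
  rw [e]
  exact Option.isSome_iff_exists.2 ⟨v, phi_mono (k := σ.length) (by simp) hv⟩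

theorem WW_up (O : ℕ → ℕ) (J : List ℕ) : Up (WW O J) := by
  rintro σ ρ ⟨s, hs, h⟩
  exact ⟨s, hs, UU_up O s _ _ h⟩

/-- decoding of query data -/
def qd (x : ℕ) : List ℕ × List Bool × ℕ := (decode x : Option (List ℕ × List Bool × ℕ)).getD ([], [], 0)

theorem qd_primrec : Primrec qd := Primrec.option_getD.comp Primrec.decode (Primrec.const _)

theorem qd_encode (y : List ℕ × List Bool × ℕ) : qd (encode y) = y := by simp [qd]

def Wl (l J : List ℕ) (τ : List Bool) : Prop := ∃ s ∈ J, Ul l s τ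

noncomputable def tst (t : ℕ) (l : List ℕ) (d : List ℕ × List Bool × ℕ) : Prop :=
  2 ^ t ≤ 2 ^ d.2.2 * (strs t).countP (fun ρ => decide (Wl l d.1 (d.2.1 ++ ρ)))

theorem tst_primrec : PrimrecPred fun p : ℕ × List ℕ × (List ℕ × List Bool × ℕ) => tst p.1 p.2.1 p.2.2 := by
  unfold tst
  have ht : Primrec fun p : ℕ × List ℕ × (List ℕ × List Bool × ℕ) => p.1 := Primrec.fst
  have hl : Primrec fun p : ℕ × List ℕ × (List ℕ × List Bool × ℕ) => p.2.1 := Primrec.fst.comp Primrec.snd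
  have hd : Primrec fun p : ℕ × List ℕ × (List ℕ × List Bool × ℕ) => p.2.2 := Primrec.snd.comp Primrec.snd
  refine Primrec.nat_le.comp (pr_pow2 ht) (Primrec.nat_mul.comp (pr_pow2 (Primrec.snd.comp (Primrec.snd.comp hd))) ?_)
  refine pr_countP (strs_primrec.comp ht) ?_
  refine pp_exists_mem (Primrec.fst.comp (hd.comp Primrec.fst)) ?_
  exact Ul_primrec (hl.comp (Primrec.fst.comp Primrec.fst)) Primrec.snd
      (Primrec.list_append.comp (Primrec.fst.comp (Primrec.snd.comp (hd.comp (Primrec.fst.comp Primrec.fst))))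
        (Primrec.snd.comp Primrec.fst))

theorem hu1 : Primrec fun n : ℕ => n.unpair.1 := Primrec.fst.comp Primrec.unpair
theorem hu2 : Primrec fun n : ℕ => n.unpair.2 := Primrec.snd.comp Primrec.unpair

noncomputable def gq (n : ℕ) : ℕ :=
  if tst n.unpair.2.unpair.2 (Denumerable.ofNat (List ℕ) n.unpair.1) (qd n.unpair.2.unpair.1) then 0 else 1

def hq (n : ℕ) : ℕ := (qd n.unpair.1).2.1.length + n.unpair.2

theorem hq_primrec : Primrec hq := Primrec.nat_add.comp (Primrec.list_length.comp
    (Primrec.fst.comp (Primrec.snd.comp (qd_primrec.comp hu1)))) hu2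

theorem gq_primrec : Primrec gq := by
  have ht : Primrec fun n : ℕ => n.unpair.2.unpair.2 := hu2.comp hu2
  have hd : Primrec fun n : ℕ => qd n.unpair.2.unpair.1 := qd_primrec.comp (hu1.comp hu2)
  have hl : Primrec fun n : ℕ => Denumerable.ofNat (List ℕ) n.unpair.1 := (Primrec.ofNat _).comp hu1
  exact Primrec.ite (tst_primrec.comp (ht.pair (hl.pair hd))) (Primrec.const 0) (Primrec.const 1)

theorem exists_query : ∃ c, ∀ (L : Set ℕ) (J : List ℕ) (τ : List Bool) (a : ℕ),
    (aidx c (encode (J, τ, a)) ∈ jump L ↔ QQ (WW (chi L) J) τ a) := by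
  obtain ⟨c, hc⟩ := (UC.rfind (UC.tableWith (Primrec.nat_iff.1 gq_primrec) (Primrec.nat_iff.1 hq_primrec))).index
  refine ⟨c, fun L J τ a => ?_⟩
  have key : ∀ t, (gq (Nat.pair (encode (table (chi L) (hq (Nat.pair (encode (J, τ, a)) t)))) (Nat.pair (encode (J, τ, a)) t)) = 0
      ↔ 2 ^ t ≤ 2 ^ a * cnt (WW (chi L) J) τ t) := by
    intro t
    have e : (strs t).countP (fun ρ => decide (Wl (table (chi L) (τ.length + t)) J (τ ++ ρ)))
        = cnt (WW (chi L) J) τ t := by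
      unfold cnt num
      apply List.countP_congr
      intro ρ hρ
      have := mem_strs.1 hρ
      subst this
      rw [decide_eq_true_iff, decide_eq_true_iff]
      simp [WW, UU, Wl]
    simp only [gq, hq, Nat.unpair_pair, qd_encode, Denumerable.ofNat_encode, tst, e]
    simp
  show (Phi (chi L) _ _).Dom ↔ _
  rw [aidx_eval, hc]
  unfold QQ
  simp only [key]
  constructor
  · intro hdom
    obtain ⟨t, ht⟩ := Part.dom_iff_mem.1 hdom
    have := (mem_rfind'.1 ht).1
    exact ⟨t, by simpa using this⟩
  · rintro ⟨t, ht⟩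
    refine Nat.rfind_dom.2 ⟨t, ?_, fun _ => trivial⟩
    simpa using ht

theorem jump_join (L B : Set ℕ) (n : ℕ) : n ∈ jump (join L B) ↔ ∃ k, UU (chi L) n (seg B k) := by
  have hj : ∀ k j, j ≤ k → jt (table (chi L) k) (seg B k) j = table (chi (join L B)) (2 * j) := by
    intro k j hjk
    unfold jt
    rw [show table (chi (join L B)) (2 * j) = (List.range (2 * j)).map (chi (join L B)) from rfl]
    apply List.map_congr_left
    intro m hm
    have hm := List.mem_range.1 hm
    rw [table_getD _ (by omega)]
    have hb : (seg B k).getD (m / 2) false = if m / 2 ∈ B then true else false := by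
      have : m / 2 < k := by omega
      simp [seg, List.getD, this]
    rw [hb]
    have hmem : m ∈ join L B ↔ if m % 2 = 0 then m / 2 ∈ L else m / 2 ∈ B := by
      unfold join
      constructor
      · rintro (⟨a, ha, rfl⟩ | ⟨a, ha, rfl⟩)
        · simpa using ha
        · have : (2 * a + 1) / 2 = a := by omega
          have h2 : (2 * a + 1) % 2 = 1 := by omega
          rw [this, h2]; simpa using ha
      · intro h
        split_ifs at h with h0
        · exact Or.inl ⟨_, h, by omega⟩
        · exact Or.inr ⟨_, h, by omega⟩
    unfold chi
    by_cases h0 : m % 2 = 0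
    · simp [hmem, h0]
    · simp only [hmem, h0, if_false]
      split_ifs <;> rfl
  have hlen : ∀ k, (seg B k).length = k := fun k => by simp [seg]
  constructor
  · intro h
    obtain ⟨v, hv⟩ := Part.dom_iff_mem.1 h
    obtain ⟨j0, hj0⟩ := phi_complete hv
    obtain ⟨k0, hk0⟩ := hj0 (2 * j0) (by omega)
    refine ⟨max j0 k0, j0, by rw [hlen]; omega, ?_⟩
    rw [hlen, hj _ _ (le_max_left _ _)]
    exact Option.isSome_iff_exists.2 ⟨v, hk0 _ (le_max_right _ _)⟩
  · rintro ⟨k, j, hjk, h⟩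
    rw [hlen] at h hjk
    rw [hj _ _ (by omega)] at h
    obtain ⟨v, hv⟩ := Option.isSome_iff_exists.1 h
    exact Part.dom_iff_mem.2 ⟨v, phi_sound hv⟩

open scoped Classical
open Encodable

/-! Part 5: the construction -/

def st (x : ℕ) : List Bool × List ℕ := (decode x : Option (List Bool × List ℕ)).getD ([], [])

theorem st_primrec : Primrec st := Primrec.option_getD.comp Primrec.decode (Primrec.const _)

theorem st_encode (y : List Bool × List ℕ) : st (encode y) = y := by simp [st]

def okv (s v0 v : ℕ) : Prop :=
  ((v - 1).unpair.1 / 2) * 2 ^ (s + 1) ≤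
    ((v0 - 1).unpair.1 / 2 + 1) * (2 ^ (s + 2) - 1) * (v - 1).unpair.2

theorem okv_primrec {α : Type} [Primcodable α] {s v0 v : α → ℕ} (hs : Primrec s) (h0 : Primrec v0)
    (hv : Primrec v) : PrimrecPred fun a => okv (s a) (v0 a) (v a) := by
  have hp : ∀ {f : α → ℕ}, Primrec f → Primrec fun a => (f a - 1).unpair.1 / 2 := fun hf =>
    Primrec.nat_div.comp (hu1.comp (Primrec.nat_sub.comp hf (Primrec.const 1))) (Primrec.const 2)
  refine Primrec.nat_le.comp (Primrec.nat_mul.comp (hp hv) (pr_pow2 (Primrec.succ.comp hs)))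
    (Primrec.nat_mul.comp (Primrec.nat_mul.comp (Primrec.succ.comp (hp h0)) (Primrec.nat_sub.comp
      (pr_pow2 (Primrec.succ.comp (Primrec.succ.comp hs))) (Primrec.const 1)))
      (hu2.comp (Primrec.nat_sub.comp hv (Primrec.const 1))))

theorem okv_iff {q0 q : ℚ} (h0 : 0 ≤ q0) (h : 0 ≤ q) (s : ℕ) :
    okv s (encode q0 + 1) (encode q + 1) ↔ q ≤ bnd ((q0.num : ℚ) + 1) (s + 1) := by
  obtain ⟨n0, hn0⟩ := Int.eq_ofNat_of_zero_le (Rat.num_nonneg.2 h0)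
  obtain ⟨n, hn⟩ := Int.eq_ofNat_of_zero_le (Rat.num_nonneg.2 h)
  have e : ∀ (q : ℚ) (n : ℕ), q.num = n → encode q = Nat.pair (2 * n) q.den := by
    intro q n hn
    have : encode q = Nat.pair (encode q.num) q.den := rfl
    rw [this, hn]; rfl
  unfold okv
  rw [Nat.add_sub_cancel, Nat.add_sub_cancel, e _ _ hn0, e _ _ hn, Nat.unpair_pair, Nat.unpair_pair]
  simp only [Nat.mul_div_cancel_left _ (show 0 < 2 by norm_num)]
  have hq : q = (n : ℚ) / q.den := by
    conv_lhs => rw [← Rat.num_div_den q, hn]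
    simp
  have hd : (0 : ℚ) < q.den := by exact_mod_cast q.den_pos
  rw [hn0]
  unfold bnd
  have e2 : ((((n0 : ℕ) : ℤ) : ℚ) + 1) * (2 - 1 / 2 ^ (s + 1)) = ((n0 : ℚ) + 1) * (2 ^ (s+2) - 1) / 2 ^ (s+1) := by
    rw [pow_succ 2 (s+1)]
    push_cast
    field_simp
  rw [e2]
  conv_rhs => rw [hq]
  rw [div_le_div_iff₀ hd (by positivity)]
  have h1 : 1 ≤ 2 ^ (s + 2) := Nat.one_le_two_pow
  rw [← Nat.cast_le (α := ℚ)]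
  push_cast [Nat.cast_sub h1]
  rfl

def mchk (r z e s : ℕ) (τ : List Bool) : Prop :=
  ∀ k < τ.length + 1, (phi r z e (encode (τ.take k))).isSome = true ∧
    okv s ((phi r z e 0).getD 0) ((phi r z e (encode (τ.take k))).getD 0)

def stp (c z e i s r : ℕ) (S S' : List Bool × List ℕ) : Prop :=
  S.1.length < S'.1.length ∧ S'.1.take S.1.length = S.1 ∧ mchk r z e s S'.1 ∧
  phi r z i (aidx c (encode (S'.2, S'.1, s + 5))) = some 0 ∧
  (S'.2 = s :: S.2 ∨ (S'.2 = S.2 ∧ phi r z i (aidx c (encode ([s], S'.1, 0))) = some 1))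

section
variable {α : Type} [Primcodable α]

theorem mchk_primrec {r z e s : α → ℕ} {τ : α → List Bool} (hr : Primrec r) (hz : Primrec z)
    (he : Primrec e) (hs : Primrec s) (hτ : Primrec τ) :
    PrimrecPred fun a => mchk (r a) (z a) (e a) (s a) (τ a) := by
  have hf : Primrec (Prod.fst : α × ℕ → α) := Primrec.fst
  have h1 : Primrec fun p : α × ℕ => phi (r p.1) (z p.1) (e p.1) (encode ((τ p.1).take p.2)) :=
    phi_primrec (hr.comp hf) (hz.comp hf) (he.comp hf)
      (Primrec.encode.comp (Primrec.list_take.comp Primrec.snd (hτ.comp hf)))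
  have h2 : Primrec fun p : α × ℕ => phi (r p.1) (z p.1) (e p.1) 0 :=
    phi_primrec (hr.comp hf) (hz.comp hf) (he.comp hf) (Primrec.const 0)
  exact pp_forall_lt (Primrec.succ.comp (Primrec.list_length.comp hτ))
    ((pp_isSome h1).and (okv_primrec (hs.comp hf) (Primrec.option_getD.comp h2 (Primrec.const 0))
      (Primrec.option_getD.comp h1 (Primrec.const 0))))

theorem stp_primrec (c : ℕ) {z e i s r : α → ℕ} {S S' : α → List Bool × List ℕ} (hz : Primrec z)
    (he : Primrec e) (hi : Primrec i) (hs : Primrec s) (hr : Primrec r) (hS : Primrec S) (hS' : Primrec S') :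
    PrimrecPred fun a => stp c (z a) (e a) (i a) (s a) (r a) (S a) (S' a) := by
  have a1 := Primrec.fst.comp hS
  have a2 := Primrec.snd.comp hS
  have b1 := Primrec.fst.comp hS'
  have b2 := Primrec.snd.comp hS'
  have q1 : Primrec fun a => phi (r a) (z a) (i a) (aidx c (encode ((S' a).2, (S' a).1, s a + 5))) :=
    phi_primrec hr hz hi ((aidx_primrec c).comp (Primrec.encode.comp (b2.pair (b1.pair
      (Primrec.nat_add.comp hs (Primrec.const 5))))))
  have q2 : Primrec fun a => phi (r a) (z a) (i a) (aidx c (encode ([s a], (S' a).1, 0))) :=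
    phi_primrec hr hz hi ((aidx_primrec c).comp (Primrec.encode.comp
      ((Primrec.list_cons.comp hs (Primrec.const [])).pair (b1.pair (Primrec.const 0)))))
  refine (Primrec.nat_lt.comp (Primrec.list_length.comp a1) (Primrec.list_length.comp b1)).and
    ((Primrec.eq.comp (Primrec.list_take.comp (Primrec.list_length.comp a1) b1) a1).and
    ((mchk_primrec hr hz he hs b1).and
    ((Primrec.eq.comp q1 (Primrec.const (some 0))).and
    ((Primrec.eq.comp b2 (Primrec.list_cons.comp hs a2)).or
      ((Primrec.eq.comp b2 a2).and (Primrec.eq.comp q2 (Primrec.const (some 1)))))))) 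
end

/-- the step test; `a = (e, i)`, `s` the stage, `x` the state, `k = (w, (j, r))`. -/
def good (c : ℕ) (O : ℕ → ℕ) (a s x k : ℕ) : Prop :=
  stp c (encode (table O k.unpair.2.unpair.1)) a.unpair.1 a.unpair.2 s k.unpair.2.unpair.2 (st x)
    (st k.unpair.1)

noncomputable def gs (c n : ℕ) : ℕ :=
  if stp c n.unpair.1 n.unpair.2.unpair.1.unpair.1.unpair.1 n.unpair.2.unpair.1.unpair.1.unpair.2
    n.unpair.2.unpair.1.unpair.2.unpair.1 n.unpair.2.unpair.2.unpair.2.unpair.2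
    (st n.unpair.2.unpair.1.unpair.2.unpair.2) (st n.unpair.2.unpair.2.unpair.1) then 0 else 1

theorem gs_primrec (c : ℕ) : Primrec (gs c) := by
  have hy : Primrec fun n : ℕ => n.unpair.2.unpair.1 := hu1.comp hu2
  have hk : Primrec fun n : ℕ => n.unpair.2.unpair.2 := hu2.comp hu2
  refine Primrec.ite ?_ (Primrec.const 0) (Primrec.const 1)
  exact stp_primrec c hu1 (hu1.comp (hu1.comp hy)) (hu2.comp (hu1.comp hy)) (hu1.comp (hu2.comp hy))
    (hu2.comp (hu2.comp hk)) (st_primrec.comp (hu2.comp (hu2.comp hy))) (st_primrec.comp (hu1.comp hk))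

def hs (n : ℕ) : ℕ := n.unpair.2.unpair.2.unpair.1
theorem hs_primrec : Primrec hs := hu1.comp (hu2.comp hu2)

noncomputable def stepx (c : ℕ) (O : ℕ → ℕ) (a s x : ℕ) : ℕ :=
  if h : ∃ k, good c O a s x k then (Nat.find h).unpair.1 else 0

noncomputable def XX (c : ℕ) (O : ℕ → ℕ) (a : ℕ) : ℕ → ℕ
  | 0 => encode (([], []) : List Bool × List ℕ)
  | s + 1 => stepx c O a s (XX c O a s)

theorem step_uc (c : ℕ) : ∃ G : (ℕ → ℕ) → ℕ →. ℕ, UC G ∧ ∀ O a s x, (∃ k, good c O a s x k) →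
    G O (Nat.pair a (Nat.pair s x)) = Part.some (stepx c O a s x) := by
  have h := (UC.rfind (UC.tableWith (Primrec.nat_iff.1 (gs_primrec c)) (Primrec.nat_iff.1 hs_primrec)))
  refine ⟨_, (UC.of_primrec Nat.Primrec.left).comp h, fun O a s x hk => ?_⟩
  have key : ∀ k, (gs c (Nat.pair (encode (table O (hs (Nat.pair (Nat.pair a (Nat.pair s x)) k))))
      (Nat.pair (Nat.pair a (Nat.pair s x)) k)) = 0 ↔ good c O a s x k) := by
    intro k
    simp only [gs, hs, Nat.unpair_pair, good]
    simp
  simp only [key]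
  have : (Nat.rfind fun n => Part.some (decide (good c O a s x n))) = Part.some (Nat.find hk) := by
    rw [Part.eq_some_iff, mem_rfind']
    refine ⟨?_, fun m hm => ?_⟩
    · simpa using Nat.find_spec hk
    · simpa using Nat.find_min hk hm
  rw [this]
  unfold stepx
  rw [dif_pos hk]
  exact Part.bind_some _ _

noncomputable def outf (p : ℕ) : ℕ := if p.unpair.1.unpair.2 ∈ (st p.unpair.2).2 then 0 else 1

theorem outf_primrec : Primrec outf := by
  refine Primrec.ite ?_ (Primrec.const 0) (Primrec.const 1)
  have : PrimrecPred fun p : ℕ => ∃ y ∈ (st p.unpair.2).2, y = p.unpair.1.unpair.2 :=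
    pp_exists_mem (Primrec.snd.comp (st_primrec.comp hu2))
      (Primrec.eq.comp Primrec.snd ((hu2.comp hu1).comp Primrec.fst))
  exact this.of_eq (by simp)

theorem iter_uc (c : ℕ) : ∃ R : (ℕ → ℕ) → ℕ →. ℕ, UC R ∧
    ∀ O a, (∀ s, ∃ k, good c O a s (XX c O a s) k) → ∀ n, R O (Nat.pair a n) = Part.some (XX c O a n) := by
  obtain ⟨G, hG, hGs⟩ := step_uc c
  have h1 := UC.prec (UC.of_primrec (Primrec.nat_iff.1 (Primrec.const
    (encode (([], []) : List Bool × List ℕ))))) hG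
  refine ⟨_, h1, fun O a hk n => ?_⟩
  have hrec : ∀ n, (Nat.rec (Part.some (encode (([], []) : List Bool × List ℕ))) (fun y IH =>
      Part.bind IH fun i => G O (Nat.pair a (Nat.pair y i))) n : Part ℕ) = Part.some (XX c O a n) := by
    intro n
    induction n with
    | zero => rfl
    | succ n ih =>
      refine (congrArg (fun p : Part ℕ => p.bind fun i => G O (Nat.pair a (Nat.pair n i))) ih).trans ?_
      refine (Part.bind_some _ _).trans ?_
      exact hGs _ _ _ _ (hk n)
  simp only [Nat.unpaired, Nat.unpair_pair]
  exact hrec n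

theorem machine (c : ℕ) : ∃ d, ∀ O a, (∀ s, ∃ k, good c O a s (XX c O a s) k) → ∀ n,
    Phi O d (Nat.pair a n) = Part.some (if n ∈ (st (XX c O a (n + 1))).2 then 0 else 1) := by
  obtain ⟨R, hR, hRs⟩ := iter_uc c
  have h2 : Primrec fun p : ℕ => Nat.pair p.unpair.1 (p.unpair.2 + 1) :=
    Primrec₂.natPair.comp hu1 (Primrec.succ.comp hu2)
  have h3 := (UC.of_primrec (Primrec.nat_iff.1 outf_primrec)).comp
    ((UC.of_primrec Nat.Primrec.id).pair (hR.comp (UC.of_primrec (Primrec.nat_iff.1 h2))))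
  obtain ⟨d, hd⟩ := h3.index
  refine ⟨d, fun O a hk n => ?_⟩
  rw [hd]
  have e : (Part.some (Nat.pair a (n + 1)) >>= R O) = Part.some (XX c O a (n + 1)) :=
    (Part.bind_some _ _).trans (hRs O a hk (n + 1))
  simp [Seq.seq, outf]
  rw [e]
  simp

open scoped Classical
open Encodable

/-! Part 6: verification -/

theorem phi_fin {O : ℕ → ℕ} (l : List (ℕ × ℕ × ℕ)) (h : ∀ p ∈ l, p.2.2 ∈ Phi O p.1 p.2.1) :
    ∃ j0, ∀ j, j0 ≤ j → ∃ k0, ∀ k, k0 ≤ k → ∀ p ∈ l, p.2.2 ∈ phi k (encode (table O j)) p.1 p.2.1 := by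
  induction l with
  | nil => exact ⟨0, fun _ _ => ⟨0, fun _ _ _ hp => by simp at hp⟩⟩
  | cons q l ih =>
    obtain ⟨j1, h1⟩ := ih fun p hp => h p (List.mem_cons_of_mem _ hp)
    obtain ⟨j2, h2⟩ := phi_complete (h q List.mem_cons_self)
    refine ⟨max j1 j2, fun j hj => ?_⟩
    obtain ⟨k1, h1⟩ := h1 j (le_trans (le_max_left _ _) hj)
    obtain ⟨k2, h2⟩ := h2 j (le_trans (le_max_right _ _) hj)
    refine ⟨max k1 k2, fun k hk p hp => ?_⟩
    rcases List.mem_cons.1 hp with rfl | hp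
    · exact h2 k (le_trans (le_max_right _ _) hk)
    · exact h1 k (le_trans (le_max_left _ _) hk) p hp

structure StInv (M : List Bool → ℚ) (O : ℕ → ℕ) (s : ℕ) (S : List Bool × List ℕ) : Prop where
  bd : ∀ k, k ≤ S.1.length → M (S.1.take k) ≤ bnd (((M []).num : ℚ) + 1) s
  dens : ¬ QQ (WW O S.2) S.1 (s + 4)
  len : s ≤ S.1.length
  lt : ∀ y ∈ S.2, y < s

/-- what a good step means -/
structure StExt (O : ℕ → ℕ) (s : ℕ) (S S' : List Bool × List ℕ) : Prop where
  pre : S.1 <+: S'.1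
  cs : S'.2 = s :: S.2 ∨ (S'.2 = S.2 ∧ QQ (WW O [s]) S'.1 0)

section
variable {M : List Bool → ℚ} {L : Set ℕ} {e i c : ℕ} {O : ℕ → ℕ}

theorem M_le (hM : IsMartingale M) : M [] ≤ ((M []).num : ℚ) + 1 := by
  have h0 := hM.1 []
  have hd : (1 : ℚ) ≤ (M []).den := by exact_mod_cast (M []).den_pos
  have hn : (0 : ℚ) ≤ (M []).num := by exact_mod_cast Rat.num_nonneg.2 h0
  have : M [] = ((M []).num : ℚ) / (M []).den := (Rat.num_div_den _).symm
  have h2 : ((M []).num : ℚ) / (M []).den ≤ (M []).num := div_le_self hn hd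
  linarith

theorem Inv_zero (hM : IsMartingale M) : StInv M (chi L) 0 ([], []) := by
  refine ⟨fun k _ => ?_, ?_, le_rfl, by simp⟩
  · have := M_le hM
    simp only [List.take_nil, bnd]; norm_num; exact this
  · rintro ⟨t, ht⟩
    have : cnt (WW (chi L) []) [] t = 0 := num_eq_zero fun ρ _ h => by simp [WW] at h
    simp only [this] at ht
    simp at ht

theorem fnOracle_M (τ : List Bool) : fnOracle M (encode τ) = encode (M τ) + 1 := by
  simp [fnOracle]

theorem exists_good (hM : IsMartingale M)
    (hc : ∀ (J : List ℕ) (τ : List Bool) (a : ℕ),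
      (aidx c (encode (J, τ, a)) ∈ jump L ↔ QQ (WW (chi L) J) τ a))
    (he : ∀ n, Phi O e n = Part.some (fnOracle M n))
    (hi : ∀ n, Phi O i n = Part.some (chi (jump L) n)) {s x : ℕ} (hx : StInv M (chi L) s (st x)) :
    ∃ k, good c O (Nat.pair e i) s x k := by
  have hn : (0 : ℚ) ≤ (M []).num := by exact_mod_cast Rat.num_nonneg.2 (hM.1 [])
  obtain ⟨ρ, hρ, hbd, hcs⟩ := exists_ext hM (m := ((M []).num : ℚ) + 1) (by linarith) s hx.bd
    (WW_up (chi L) (st x).2) (WW_up (chi L) (s :: (st x).2)) (U := UU (chi L) s)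
    (fun τ => by simp [WW]) hx.dens (s + 5)
  set τ := (st x).1 ++ ρ with hτ
  obtain ⟨J', hJ1, hJ2⟩ : ∃ J', ¬ QQ (WW (chi L) J') τ (s + 5) ∧
      (J' = s :: (st x).2 ∨ (J' = (st x).2 ∧ QQ (WW (chi L) [s]) τ 0)) := by
    rcases hcs with h | ⟨h, hu⟩
    · exact ⟨_, h, Or.inl rfl⟩
    · refine ⟨_, h, Or.inr ⟨rfl, 0, ?_⟩⟩
      rw [cnt_full (WW_up _ _) ⟨s, by simp, hu⟩]; simp
  obtain ⟨j, hj⟩ := phi_fin (O := O)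
    (((List.range (τ.length + 1)).map fun k => (e, encode (τ.take k), fnOracle M (encode (τ.take k)))) ++
      [(i, aidx c (encode (J', τ, s + 5)), chi (jump L) (aidx c (encode (J', τ, s + 5)))),
       (i, aidx c (encode ([s], τ, 0)), chi (jump L) (aidx c (encode ([s], τ, 0))))]) (by
    intro p hp
    simp only [List.mem_append, List.mem_map, List.mem_cons, List.not_mem_nil, or_false] at hp
    rcases hp with ⟨k, _, rfl⟩ | rfl | rfl
    · exact Part.eq_some_iff.1 (he _)
    · exact Part.eq_some_iff.1 (hi _)
    · exact Part.eq_some_iff.1 (hi _))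
  obtain ⟨r, hr⟩ := hj j le_rfl
  have hr := hr r le_rfl
  simp only [List.mem_append, List.mem_map, List.mem_cons, List.not_mem_nil, or_false] at hr
  have hre : ∀ k, k < τ.length + 1 → phi r (encode (table O j)) e (encode (τ.take k)) =
      some (encode (M (τ.take k)) + 1) := fun k hk => by
    have := hr _ (Or.inl ⟨k, List.mem_range.2 hk, rfl⟩)
    rw [fnOracle_M] at this
    exact this
  have hr1 : phi r (encode (table O j)) i (aidx c (encode (J', τ, s + 5))) = _ :=
    hr _ (Or.inr (Or.inl rfl))
  have hr2 : phi r (encode (table O j)) i (aidx c (encode ([s], τ, 0))) = _ :=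
    hr _ (Or.inr (Or.inr rfl))
  have hre0 : phi r (encode (table O j)) e 0 = some (encode (M []) + 1) := hre 0 (by omega)
  refine ⟨Nat.pair (encode (τ, J')) (Nat.pair j r), ?_⟩
  simp only [good, Nat.unpair_pair, st_encode]
  refine ⟨?_, ?_, ?_, ?_, ?_⟩
  · simp only [hτ, List.length_append]; omega
  · simp only [hτ]; simp
  · intro k hk
    simp only at hk
    simp only [hre k hk, hre0]
    refine ⟨rfl, ?_⟩
    exact (okv_iff (hM.1 _) (hM.1 _) s).2 (hbd k (by omega))
  · refine hr1.trans ?_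
    exact congrArg some (if_neg (mt (hc J' τ (s + 5)).1 hJ1))
  · rcases hJ2 with h | ⟨h, h'⟩
    · exact Or.inl h
    · refine Or.inr ⟨h, ?_⟩
      refine hr2.trans ?_
      exact congrArg some (if_pos ((hc _ _ _).2 h'))

theorem good_spec (hM : IsMartingale M)
    (hc : ∀ (J : List ℕ) (τ : List Bool) (a : ℕ),
      (aidx c (encode (J, τ, a)) ∈ jump L ↔ QQ (WW (chi L) J) τ a))
    (he : ∀ n, Phi O e n = Part.some (fnOracle M n))
    (hi : ∀ n, Phi O i n = Part.some (chi (jump L) n)) {s x k : ℕ} (hx : StInv M (chi L) s (st x))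
    (hk : good c O (Nat.pair e i) s x k) :
    StInv M (chi L) (s + 1) (st k.unpair.1) ∧ StExt (chi L) s (st x) (st k.unpair.1) := by
  unfold good at hk
  simp only [Nat.unpair_pair] at hk
  set S' := st k.unpair.1
  set z := encode (table O k.unpair.2.unpair.1) with hz
  set r := k.unpair.2.unpair.2
  obtain ⟨h1, h2, h3, h4, h5⟩ := hk
  have hse : ∀ n v, phi r z e n = some v → v = fnOracle M n := by
    intro n v h
    have := phi_sound (O := O) h
    rw [he] at this
    simpa using this
  have hsi : ∀ n v, phi r z i n = some v → v = chi (jump L) n := by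
    intro n v h
    have := phi_sound (O := O) h
    rw [hi] at this
    simpa using this
  have hS2 : ∀ y ∈ S'.2, y < s + 1 := by
    intro y hy
    rcases h5 with h | ⟨h, -⟩
    · rw [h] at hy
      rcases List.mem_cons.1 hy with rfl | hy
      · omega
      · have := hx.lt y hy; omega
    · rw [h] at hy; have := hx.lt y hy; omega
  refine ⟨⟨?_, ?_, ?_, hS2⟩, ⟨?_, ?_⟩⟩
  · intro k hk
    obtain ⟨ha, hb⟩ := h3 k (by omega)
    obtain ⟨v, hv⟩ := Option.isSome_iff_exists.1 ha
    obtain ⟨v0, hv0⟩ := Option.isSome_iff_exists.1 (h3 0 (by omega)).1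
    have hv0' : phi r z e 0 = some v0 := hv0
    rw [hv, hv0', hse _ _ hv, hse _ _ hv0] at hb
    simp only [Option.getD_some] at hb
    rw [fnOracle_M, fnOracle_M] at hb
    exact (okv_iff (hM.1 _) (hM.1 _) s).1 hb
  · intro hq
    have := hsi _ _ h4
    rw [chi, if_pos ((hc _ _ _).2 hq)] at this
    omega
  · have := hx.len; omega
  · rw [← h2]; exact List.take_prefix _ _
  · rcases h5 with h | ⟨h, h'⟩
    · exact Or.inl h
    · refine Or.inr ⟨h, ?_⟩
      have := hsi _ _ h'
      by_contra hq
      rw [chi, if_neg (mt (hc _ _ _).1 hq)] at this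
      omega

theorem run (hM : IsMartingale M)
    (hc : ∀ (J : List ℕ) (τ : List Bool) (a : ℕ),
      (aidx c (encode (J, τ, a)) ∈ jump L ↔ QQ (WW (chi L) J) τ a))
    (he : ∀ n, Phi O e n = Part.some (fnOracle M n))
    (hi : ∀ n, Phi O i n = Part.some (chi (jump L) n)) :
    (∀ s, ∃ k, good c O (Nat.pair e i) s (XX c O (Nat.pair e i) s) k) ∧
    ∀ s, StInv M (chi L) s (st (XX c O (Nat.pair e i) s)) ∧
      StExt (chi L) s (st (XX c O (Nat.pair e i) s)) (st (XX c O (Nat.pair e i) (s + 1))) := by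
  have step : ∀ s, StInv M (chi L) s (st (XX c O (Nat.pair e i) s)) →
      StInv M (chi L) (s + 1) (st (XX c O (Nat.pair e i) (s + 1))) ∧
      StExt (chi L) s (st (XX c O (Nat.pair e i) s)) (st (XX c O (Nat.pair e i) (s + 1))) := by
    intro s hs
    have hk := exists_good hM hc he hi hs
    rw [XX, stepx, dif_pos hk]
    exact good_spec hM hc he hi hs (Nat.find_spec hk)
  have inv : ∀ s, StInv M (chi L) s (st (XX c O (Nat.pair e i) s)) := by
    intro s
    induction s with
    | zero => rw [XX, st_encode]; exact Inv_zero hM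
    | succ s ih => exact (step s ih).1
  exact ⟨fun s => exists_good hM hc he hi (inv s), fun s => ⟨inv s, (step s (inv s)).2⟩⟩

theorem conclude (S : ℕ → List Bool × List ℕ)
    (hS : ∀ s, StInv M (chi L) s (S s) ∧ StExt (chi L) s (S s) (S (s + 1))) (hM : IsMartingale M) :
    ∃ B : Set ℕ, ¬ Succeeds M B ∧
      ∀ n, (if n ∈ (S (n + 1)).2 then 0 else 1) = chi (jump (join L B)) n := by
  have hpre : ∀ s d, (S s).1 <+: (S (s + d)).1 := by
    intro s d
    induction d with
    | zero => exact List.prefix_rfl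
    | succ d ih => exact ih.trans (hS (s + d)).2.pre
  have hget : ∀ s d n, n < (S s).1.length → (S (s + d)).1.getD n false = (S s).1.getD n false := by
    intro s d n hn
    obtain ⟨u, hu⟩ := hpre s d
    rw [← hu]
    simp only [List.getD]
    rw [List.getElem?_append_left hn]
  let B : Set ℕ := {n | ∃ s, (S s).1.getD n false = true}
  have hB : ∀ s n, n < (S s).1.length → (n ∈ B ↔ (S s).1.getD n false = true) := by
    intro s n hn
    refine ⟨?_, fun h => ⟨s, h⟩⟩
    rintro ⟨u, hu⟩
    rcases le_total s u with h | h
    · obtain ⟨d, rfl⟩ := Nat.exists_eq_add_of_le h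
      rwa [hget s d n hn] at hu
    · obtain ⟨d, rfl⟩ := Nat.exists_eq_add_of_le h
      have : n < (S u).1.length := by
        by_contra hcon
        rw [List.getD_eq_default _ _ (by omega)] at hu
        simp at hu
      rwa [hget u d n this]
  have hseg : ∀ s k, k ≤ (S s).1.length → seg B k = (S s).1.take k := by
    intro s k hk
    apply List.ext_getElem
    · simp [seg, hk]
    · intro n h1 h2
      have hn : n < k := by simpa [seg] using h1
      have := hB s n (by omega)
      rw [List.getD_eq_getElem _ _ (by omega)] at this
      simp only [seg, List.getElem_map, List.getElem_range, List.getElem_take, this]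
      split_ifs with h <;> simp_all
  have htake : ∀ k n, k ≤ n → (seg B n).take k = seg B k := by
    intro k n h
    simp [seg, ← List.map_take, List.take_range, h]
  refine ⟨B, ?_, fun n => ?_⟩
  · intro hs
    obtain ⟨n, hn⟩ := hs (2 * (((M []).num : ℚ) + 1))
    have h1 := (hS n).1.bd n (hS n).1.len
    rw [← hseg n n (hS n).1.len] at h1
    have hn0 : (0 : ℚ) ≤ (M []).num := by exact_mod_cast Rat.num_nonneg.2 (hM.1 [])
    have : bnd (((M []).num : ℚ) + 1) n ≤ 2 * (((M []).num : ℚ) + 1) := by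
      unfold bnd
      have : (0 : ℚ) ≤ 1 / 2 ^ n := by positivity
      nlinarith
    linarith
  · by_cases hmem : n ∈ (S (n + 1)).2
    · rw [if_pos hmem]
      have hJ : ∀ d, n ∈ (S (n + 1 + d)).2 := by
        intro d
        induction d with
        | zero => exact hmem
        | succ d ih =>
          rcases (hS (n + 1 + d)).2.cs with h | ⟨h, -⟩
          · show n ∈ (S (n + 1 + d + 1)).2
            rw [h]; exact List.mem_cons_of_mem _ ih
          · show n ∈ (S (n + 1 + d + 1)).2
            rw [h]; exact ih
      have : n ∉ jump (join L B) := by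
        rw [jump_join]
        rintro ⟨k, hk⟩
        refine (hS (n + 1 + k)).1.dens ⟨0, ?_⟩
        have hlen : k ≤ (S (n + 1 + k)).1.length := by have := (hS (n + 1 + k)).1.len; omega
        have hu : WW (chi L) (S (n + 1 + k)).2 (S (n + 1 + k)).1 := by
          refine ⟨n, hJ k, ?_⟩
          rw [hseg _ _ hlen] at hk
          have := UU_up _ _ _ ((S (n + 1 + k)).1.drop k) hk
          rwa [List.take_append_drop] at this
        rw [cnt_full (WW_up _ _) hu]
        simp [Nat.one_le_two_pow]
      simp [chi, this]
    · rw [if_neg hmem]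
      have hq : QQ (WW (chi L) [n]) (S (n + 1)).1 0 := by
        rcases (hS n).2.cs with h | ⟨-, h⟩
        · rw [h] at hmem; simp at hmem
        · exact h
      obtain ⟨t, ht⟩ := hq
      have : n ∈ jump (join L B) := by
        rw [jump_join]
        refine ⟨(S (n + 1)).1.length + t, ?_⟩
        set a := (S (n + 1)).1.length with ha
        have h1 : (seg B (a + t)).take a = (S (n + 1)).1 := by
          rw [htake _ _ (by omega), hseg (n + 1) a le_rfl, ha, List.take_length]
        have h2 : (strs t).countP (fun ρ => decide (WW (chi L) [n] ((S (n + 1)).1 ++ ρ))) = (strs t).length := by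
          apply le_antisymm List.countP_le_length
          rw [strs_length]; simpa [cnt, num] using ht
        rw [List.countP_eq_length] at h2
        have h3 := h2 ((seg B (a + t)).drop a) (mem_strs.2 (by simp [seg]))
        rw [decide_eq_true_iff, ← h1, List.take_append_drop] at h3
        obtain ⟨y, hy, hu⟩ := h3
        rw [List.mem_singleton] at hy
        rwa [hy] at hu
      simp [chi, this]
end

theorem stmt5 :
    ∃ f : ℕ × ℕ → ℕ, FRed f (jump K) ∧
      ∀ (e i : ℕ) (M : List Bool → ℚ) (L : Set ℕ),
        IsMartingale M →
        (∀ n, Phi (chi K) e n = Part.some (fnOracle M n)) →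
        Low L →
        (∀ n, Phi (chi K) i n = Part.some (chi (jump L) n)) →
        ∃ B : Set ℕ, ¬ Succeeds M B ∧
          ∀ n, Phi (chi K) (f (e, i)) n = Part.some (chi (jump (join L B)) n) := by
  obtain ⟨c, hc⟩ := exists_query
  obtain ⟨d, hd⟩ := machine c
  refine ⟨fun p => sidx d (Nat.pair p.1 p.2), ?_, ?_⟩
  · have h : Primrec (fnOracle fun p : ℕ × ℕ => sidx d (Nat.pair p.1 p.2)) := by
      have : Primrec fun n : ℕ => sidx d n + 1 := Primrec.succ.comp (sidx_primrec d)
      refine this.of_eq fun n => ?_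
      simp [fnOracle]
    exact RecIn.of_primrec (Primrec.nat_iff.1 h)
  · intro e i M L hM he _ hi
    obtain ⟨h1, h2⟩ := run hM (hc L) he hi
    obtain ⟨B, hB1, hB2⟩ := conclude (fun s => st (XX c (chi K) (Nat.pair e i) s)) h2 hM
    refine ⟨B, hB1, fun n => ?_⟩
    rw [sidx_eval, hd _ _ h1 n, hB2]
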